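/- Let m ≥ 2 and G = gl(m|1), acting on V via ρ. Define g : G×G → V by g(A,B) = Str(A)·ι_{y(B)}(e₁∧⋯∧e_m) − Str(B)·ι_{y(A)}(e₁∧⋯∧e_m) ∈ V₁, where y(C) ∈ (𝕂^m)* denotes the bottom-left 1×m block of C read as a covector. Then g is a 2-cocycle of G with coefficients in V, g is not a 2-coboundary, and every 2-cocycle of G with coefficients in V is the sum of a scalar multiple of g and a 2-coboundary; in particular H²(G,V) is one-dimensional. -/

import Mathlib

open ExteriorAlgebra

open Matrix

variable (K : Type) [Field K]

/-- The space of matrices underlying `gl(m|n)`. -/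
abbrev gl (m n : ℕ) : Type := Matrix (Fin (m + n)) (Fin (m + n)) K

/-- The parity of an index: indices `< m` are even, the rest odd. -/
def par (m n : ℕ) (i : Fin (m + n)) : ZMod 2 := if (i : ℕ) < m then 0 else 1

/-- `A` is homogeneous of parity `p`. -/
def IsHom {m n : ℕ} (p : ZMod 2) (A : gl K m n) : Prop :=
  ∀ i j, A i j ≠ 0 → par m n i + par m n j = p

/-- The sign `(-1)^p` for `p : ZMod 2`. -/
def sg (p : ZMod 2) : K := if p = 0 then 1 else -1

/-- The even (block-diagonal) part of a matrix. -/
def evenP {m n : ℕ} (A : gl K m n) : gl K m n :=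
  Matrix.of fun i j => if par m n i = par m n j then A i j else 0

/-- The odd (block-off-diagonal) part of a matrix. -/
def oddP {m n : ℕ} (A : gl K m n) : gl K m n :=
  Matrix.of fun i j => if par m n i = par m n j then 0 else A i j

/-- The super bracket `⟨A,B⟩ = AB - (-1)^{|A||B|} BA` on homogeneous elements,
extended bilinearly to all of `gl(m|n)`. -/
def sbr {m n : ℕ} (A B : gl K m n) : gl K m n :=
  A * B - evenP K B * A - oddP K B * evenP K A + oddP K B * oddP K A

/-- The supertrace `Str(A) = Tr(a) - Tr(d)`. -/
def str {m n : ℕ} (A : gl K m n) : K := ∑ i, sg K (par m n i) * A i i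

/-- `sl(m|n)`, the subspace of supertraceless matrices, as a submodule of `gl(m|n)`. -/
def sl (m n : ℕ) : Submodule K (gl K m n) where
  carrier := {A | str K A = 0}
  add_mem' {A B} hA hB := by
    simp only [Set.mem_setOf_eq, str] at *
    simp [Matrix.add_apply, mul_add, Finset.sum_add_distrib, hA, hB]
  zero_mem' := by simp [str]
  smul_mem' c A hA := by
    simp only [Set.mem_setOf_eq, str] at *
    simp only [Matrix.smul_apply, smul_eq_mul, mul_left_comm, ← Finset.mul_sum, hA, mul_zero]

/-- The exterior algebra `Λ(E)` over `E = 𝕂^m`. -/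
abbrev ExtAlg (m : ℕ) : Type := ExteriorAlgebra K (Fin m → K)

/-- The ambient space carrying `V = ⊕_{r=1}^m V_r`: an `m`-tuple of elements of `Λ(E)`,
the component indexed by `r : Fin m` standing for the piece `V_{r+1} = ⋀^{m-1-r} E`. -/
abbrev Wam (m : ℕ) : Type := Fin m → ExtAlg K m

/-- Left exterior multiplication `ω ↦ v ∧ ω` by a vector `v ∈ E`. -/
def wmul {m : ℕ} (v : Fin m → K) : ExtAlg K m →ₗ[K] ExtAlg K m :=
  LinearMap.mulLeft K (ExteriorAlgebra.ι K v)

/-- Contraction (interior product) `ι_y` by a covector `y ∈ E*`. -/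
def ctr {m : ℕ} (y : Module.Dual K (Fin m → K)) : ExtAlg K m →ₗ[K] ExtAlg K m :=
  CliffordAlgebra.contractLeft y

/-- The derivation action `θ_a` of a matrix `a ∈ M_m(𝕂)` on the exterior algebra,
`θ_a (v₁ ∧ … ∧ v_k) = Σᵢ v₁ ∧ … ∧ (a vᵢ) ∧ … ∧ v_k`; concretely
`θ_a = Σ_{i,j} a_{ij} (e_i ∧ -) ∘ ι_{e_j*}`. -/
def theta {m : ℕ} (a : Matrix (Fin m) (Fin m) K) : ExtAlg K m →ₗ[K] ExtAlg K m :=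
  ∑ i, ∑ j, a i j • (wmul K (Pi.single i 1) ∘ₗ ctr K (LinearMap.proj j))

/-- The upper-left `m×m` block `a` of `A ∈ gl(m|1)`. -/
def blka {m : ℕ} (A : gl K m 1) : Matrix (Fin m) (Fin m) K :=
  Matrix.of fun i j => A (Fin.castSucc i) (Fin.castSucc j)

/-- The upper-right column `x` of `A ∈ gl(m|1)`. -/
def blkx {m : ℕ} (A : gl K m 1) : Fin m → K :=
  fun i => A (Fin.castSucc i) (Fin.last m)

/-- The lower-left row `y` of `A ∈ gl(m|1)`, as a covector. -/
def blky {m : ℕ} (A : gl K m 1) : Module.Dual K (Fin m → K) :=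
  ∑ j, A (Fin.last m) (Fin.castSucc j) • (LinearMap.proj j :  (Fin m → K) →ₗ[K] K)

/-- The lower-right entry `d` of `A ∈ gl(m|1)`. -/
def blkd {m : ℕ} (A : gl K m 1) : K := A (Fin.last m) (Fin.last m)

/-- Component `r` of the action `ρ(A)` on `V = ⊕_{r=1}^m V_r` (slot `r` standing for
`V_{r+1}`, `r = 0, …, m-1`): on `ω ∈ V_r` (paper numbering `r = 1, …, m`) it is
`θ_a ω - (Tr a) ω + r d ω` into `V_r`, plus `(r-1)(x ∧ ω)` into `V_{r-1}`, plus
`ι_y ω` into `V_{r+1}`. -/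
def rhoComp {m : ℕ} (A : gl K m 1) (r : Fin m) : Wam K m →ₗ[K] ExtAlg K m :=
  (theta K (blka K A) - (Matrix.trace (blka K A)) • LinearMap.id
      + ((((r : ℕ) + 1 : ℕ) : K) * blkd K A) • LinearMap.id) ∘ₗ LinearMap.proj r
    + (if h : (r : ℕ) + 1 < m then
        ((((r : ℕ) + 1 : ℕ) : K) • (wmul K (blkx K A) ∘ₗ LinearMap.proj (⟨(r : ℕ) + 1, h⟩ : Fin m)))
      else 0)
    + (if _h : 0 < (r : ℕ) then
        (ctr K (blky K A) ∘ₗ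
          LinearMap.proj (⟨(r : ℕ) - 1, lt_of_le_of_lt (Nat.sub_le _ 1) r.isLt⟩ : Fin m))
      else 0)

/-- The representation `ρ` of `gl(m|1)` on (the ambient space of) `V`. -/
def rho {m : ℕ} (A : gl K m 1) : Wam K m →ₗ[K] Wam K m :=
  LinearMap.pi (rhoComp K A)

/-- The submodule `V = ⊕_{r=1}^m V_r` with `V_r = ⋀^{m-r} E`. -/
def Vsub (m : ℕ) : Submodule K (Wam K m) :=
  Submodule.pi Set.univ fun r => ⋀[K]^(m - 1 - (r : ℕ)) (Fin m → K)

/-- The parity-`p` part of `V`: the sum of those `V_r` with `(m - r) % 2 = p`. -/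
def Vpart (m : ℕ) (p : ZMod 2) : Submodule K (Wam K m) :=
  Submodule.pi Set.univ fun r =>
    if ((m - 1 - (r : ℕ) : ℕ) : ZMod 2) = p then ⋀[K]^(m - 1 - (r : ℕ)) (Fin m → K) else ⊥

/-- The top wedge `e₁ ∧ e₂ ∧ … ∧ e_m ∈ ⋀^m E`. -/
def topWedge (m : ℕ) : ExtAlg K m :=
  (List.ofFn fun i : Fin m => ExteriorAlgebra.ι K (Pi.single i (1 : K))).prod

/-- `η_k = ι_{e_k*}(e₁ ∧ … ∧ e_m) ∈ ⋀^{m-1} E`. -/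
def eta {m : ℕ} (k : Fin m) : ExtAlg K m :=
  ctr K (LinearMap.proj k) (topWedge K m)
/-- The distinguished 2-cochain
`g(A,B) = Str(A)·ι_{y(B)}(e₁∧⋯∧e_m) − Str(B)·ι_{y(A)}(e₁∧⋯∧e_m) ∈ V₁`
(sitting in slot `0`, which is the piece `V₁ = ⋀^{m-1}E`), where `y(C)` is the bottom-left
`1×m` block of `C` read as a covector. -/
def gV (m : ℕ) (hm : 0 < m) (A B : gl K m 1) : Wam K m :=
  Pi.single (⟨0, hm⟩ : Fin m)
    (str K A • ctr K (blky K B) (topWedge K m) - str K B • ctr K (blky K A) (topWedge K m))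

section ExteriorPower

variable {m : ℕ}

lemma wmul_apply (v : Fin m → K) (ω : ExtAlg K m) :
    wmul K v ω = ExteriorAlgebra.ι K v * ω := rfl

lemma wmul_wmul_self (v : Fin m → K) (ω : ExtAlg K m) : wmul K v (wmul K v ω) = 0 := by
  simp [wmul_apply, ← mul_assoc]

lemma ctr_wmul (y : Module.Dual K (Fin m → K)) (v : Fin m → K) (ω : ExtAlg K m) :
    ctr K y (wmul K v ω) = y v • ω - wmul K v (ctr K y ω) :=
  CliffordAlgebra.contractLeft_ι_mul y v ω

lemma wmul_ctr (y : Module.Dual K (Fin m → K)) (v : Fin m → K) (ω : ExtAlg K m) :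
    wmul K v (ctr K y ω) = y v • ω - ctr K y (wmul K v ω) := by
  rw [ctr_wmul, sub_sub_cancel]

lemma ctr_ctr (y z : Module.Dual K (Fin m → K)) (ω : ExtAlg K m) :
    ctr K y (ctr K z ω) = -ctr K z (ctr K y ω) :=
  CliffordAlgebra.contractLeft_comm (d := y) (d' := z) ω

lemma ctr_add (y z : Module.Dual K (Fin m → K)) : ctr K (y + z) = ctr K y + ctr K z :=
  map_add CliffordAlgebra.contractLeft y z

lemma ctr_smul (c : K) (y : Module.Dual K (Fin m → K)) : ctr K (c • y) = c • ctr K y :=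
  map_smul CliffordAlgebra.contractLeft c y

lemma ctr_zero : ctr K (0 : Module.Dual K (Fin m → K)) = 0 :=
  map_zero CliffordAlgebra.contractLeft

lemma ctr_sum {ι : Type*} (s : Finset ι) (y : ι → Module.Dual K (Fin m → K)) :
    ctr K (∑ i ∈ s, y i) = ∑ i ∈ s, ctr K (y i) :=
  map_sum CliffordAlgebra.contractLeft y s

lemma wmul_add (v w : Fin m → K) : wmul K (v + w) = wmul K v + wmul K w := by
  refine LinearMap.ext fun ω => ?_
  simp [wmul_apply, add_mul]

lemma wmul_smul (c : K) (v : Fin m → K) : wmul K (c • v) = c • wmul K v := by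
  refine LinearMap.ext fun ω => ?_
  simp [wmul_apply]

lemma wmul_sum {ι : Type*} (s : Finset ι) (v : ι → Fin m → K) :
    wmul K (∑ i ∈ s, v i) = ∑ i ∈ s, wmul K (v i) := by
  refine LinearMap.ext fun ω => ?_
  simp [wmul_apply, Finset.sum_mul]

lemma wmul_mem {k : ℕ} {ω : ExtAlg K m} (v : Fin m → K) (h : ω ∈ ⋀[K]^k (Fin m → K)) :
    wmul K v ω ∈ ⋀[K]^(k + 1) (Fin m → K) := by
  unfold exteriorPower
  rw [pow_succ']
  exact Submodule.mul_mem_mul ⟨v, rfl⟩ h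

lemma ctr_mem {k : ℕ} {ω : ExtAlg K m} (y : Module.Dual K (Fin m → K))
    (h : ω ∈ ⋀[K]^k (Fin m → K)) :
    ctr K y ω ∈ ⋀[K]^(k - 1) (Fin m → K) := by
  induction h using Submodule.pow_induction_on_left' with
  | algebraMap r =>
    rw [ctr, CliffordAlgebra.contractLeft_algebraMap]; exact zero_mem _
  | add x z i _ _ hx hz => rw [map_add]; exact add_mem hx hz
  | mem_mul v hv i x hx ih =>
    obtain ⟨v, rfl⟩ := hv
    have := ctr_wmul K y v x
    rw [wmul_apply] at this
    rw [this]
    refine sub_mem (Submodule.smul_mem _ _ hx) ?_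
    rcases i with _ | i
    · obtain ⟨r, rfl⟩ := Submodule.mem_one.1 (by simpa using hx)
      rw [ctr, CliffordAlgebra.contractLeft_algebraMap, map_zero]; exact zero_mem _
    · exact wmul_mem K v ih

/-- Euler's formula: `Σ eᵢ ∧ ι_{eᵢ*}` is the degree operator. -/
lemma euler {k : ℕ} {ω : ExtAlg K m} (h : ω ∈ ⋀[K]^k (Fin m → K)) :
    ∑ i, wmul K (Pi.single i 1) (ctr K (LinearMap.proj i) ω) = (k : K) • ω := by
  induction h using Submodule.pow_induction_on_left' with
  | algebraMap r => simp [ctr, CliffordAlgebra.contractLeft_algebraMap]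
  | add x z i _ _ hx hz => simp [Finset.sum_add_distrib, hx, hz]
  | mem_mul v hv i x hx ih =>
    obtain ⟨v, rfl⟩ := hv
    have h1 : ∑ j, v j • (Pi.single j (1 : K) : Fin m → K) = v := by
      ext l; simp [Pi.single_apply]
    have h2 : ∀ j : Fin m, wmul K (Pi.single j 1) (ctr K (LinearMap.proj j) (wmul K v x))
        = wmul K (v j • Pi.single j (1 : K)) x
          + wmul K v (wmul K (Pi.single j 1) (ctr K (LinearMap.proj j) x)) := by
      intro j
      rw [ctr_wmul, map_sub, wmul_smul]
      have := CliffordAlgebra.ι_mul_ι_add_swap (Q := (0 : QuadraticForm K (Fin m → K)))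
        (Pi.single j 1) v
      have h3 : wmul K (Pi.single j 1) (wmul K v (ctr K (LinearMap.proj j) x))
          = -wmul K v (wmul K (Pi.single j 1) (ctr K (LinearMap.proj j) x)) := by
        simp only [wmul_apply, ← mul_assoc]
        rw [eq_neg_iff_add_eq_zero, ← add_mul, ExteriorAlgebra.ι_add_mul_swap, zero_mul]
      rw [h3]
      simp
    change ∑ j, wmul K (Pi.single j 1) (ctr K (LinearMap.proj j) (wmul K v x)) = _ • wmul K v x
    rw [Finset.sum_congr rfl fun j _ => h2 j, Finset.sum_add_distrib, ← map_sum, ih,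
      ← LinearMap.sum_apply, ← wmul_sum, h1, map_smul]
    push_cast
    module

lemma sum_ctr_wmul {k : ℕ} {ω : ExtAlg K m} (h : ω ∈ ⋀[K]^k (Fin m → K)) :
    ∑ i, ctr K (LinearMap.proj i) (wmul K (Pi.single i 1) ω) = ((m : K) - k) • ω := by
  simp only [ctr_wmul, Finset.sum_sub_distrib, euler K h]
  simp [sub_smul, Nat.cast_smul_eq_nsmul]

lemma eq_zero_of_wmul_eq_zero [CharZero K] {k : ℕ} (hk : k < m) {ω : ExtAlg K m}
    (h : ω ∈ ⋀[K]^k (Fin m → K)) (h0 : ∀ i, wmul K (Pi.single i 1) ω = 0) : ω = 0 := by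
  have := sum_ctr_wmul K h
  simp only [h0, map_zero, Finset.sum_const_zero] at this
  have h2 : (m : K) - k ≠ 0 := sub_ne_zero.2 (by exact_mod_cast hk.ne')
  exact (smul_eq_zero.1 this.symm).resolve_left h2

lemma topWedge_eq : topWedge K m = ExteriorAlgebra.ιMulti K m (fun i => Pi.single i 1) :=
  (ExteriorAlgebra.ιMulti_apply _).symm

lemma topWedge_mem : topWedge K m ∈ ⋀[K]^m (Fin m → K) := by
  rw [topWedge_eq]
  exact ExteriorAlgebra.ιMulti_range K m ⟨_, rfl⟩

lemma wmul_single_topWedge (i : Fin m) : wmul K (Pi.single i 1) (topWedge K m) = 0 := by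
  have := ExteriorAlgebra.ιMulti_succ_apply (R := K)
    (Fin.cons (Pi.single i (1 : K)) (fun i => Pi.single i 1) : Fin (m + 1) → Fin m → K)
  rw [topWedge_eq, wmul_apply]
  simp only [Fin.cons_zero] at this
  refine Eq.trans ?_ (this.symm.trans ?_)
  · rfl
  · exact AlternatingMap.map_eq_zero_of_eq _ _ (i := 0) (j := i.succ) (by simp)
      (Fin.succ_ne_zero i).symm

lemma wmul_topWedge (v : Fin m → K) : wmul K v (topWedge K m) = 0 := by
  have h1 : v = ∑ j, v j • (Pi.single j (1 : K) : Fin m → K) := by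
    ext l; simp [Pi.single_apply]
  rw [h1, wmul_sum, LinearMap.sum_apply]
  simp [wmul_smul, wmul_single_topWedge]

/-- The coefficient of `e₁ ∧ ⋯ ∧ e_m`. -/
noncomputable def topCoeff (m : ℕ) : ExtAlg K m →ₗ[K] K :=
  ExteriorAlgebra.liftAlternating
    (Function.update 0 m (Matrix.detRowAlternating : (Fin m → K) [⋀^Fin m]→ₗ[K] K))

lemma topCoeff_ιMulti (v : Fin m → Fin m → K) :
    topCoeff K m (ExteriorAlgebra.ιMulti K m v) = Matrix.det (Matrix.of v) := by
  rw [topCoeff, ExteriorAlgebra.liftAlternating_apply_ιMulti, Function.update_self]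
  rfl

lemma topCoeff_topWedge : topCoeff K m (topWedge K m) = 1 := by
  rw [topWedge_eq, topCoeff_ιMulti]
  convert Matrix.det_one (n := Fin m) (R := K) using 2
  ext i j
  simp [Matrix.one_apply, Pi.single_apply, eq_comm]

lemma eq_topCoeff_smul {ω : ExtAlg K m} (h : ω ∈ ⋀[K]^m (Fin m → K)) :
    ω = topCoeff K m ω • topWedge K m := by
  have h1 : ExteriorAlgebra.ιMulti K m
      = (LinearMap.toSpanSingleton K _ (topWedge K m)).compAlternatingMap
        (Matrix.detRowAlternating : (Fin m → K) [⋀^Fin m]→ₗ[K] K) := by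
    refine Module.Basis.ext_alternating (Pi.basisFun K (Fin m)) fun v hv => ?_
    let σ : Equiv.Perm (Fin m) := Equiv.ofBijective v (Finite.injective_iff_bijective.1 hv)
    change (ExteriorAlgebra.ιMulti K m) (Pi.basisFun K (Fin m) ∘ σ)
      = (LinearMap.compAlternatingMap _ _) (Pi.basisFun K (Fin m) ∘ σ)
    rw [AlternatingMap.map_perm, AlternatingMap.map_perm]
    congr 1
    have h2 : topCoeff K m (topWedge K m) = 1 := topCoeff_topWedge K
    rw [topWedge_eq, topCoeff_ιMulti] at h2
    have h3 : (Pi.basisFun K (Fin m) : Fin m → Fin m → K) = fun i => Pi.single i 1 := by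
      ext1 i; simp
    rw [h3, ← topWedge_eq]
    change topWedge K m
      = Matrix.det (Matrix.of fun i : Fin m => (Pi.single i 1 : Fin m → K)) • topWedge K m
    rw [h2, one_smul]
  rw [← ExteriorAlgebra.ιMulti_span_fixedDegree] at h
  induction h using Submodule.span_induction with
  | mem x hx =>
    obtain ⟨v, rfl⟩ := hx
    rw [topCoeff_ιMulti, topWedge_eq]
    exact DFunLike.congr_fun h1 v
  | zero => simp
  | add x y _ _ hx hy => rw [map_add, add_smul, ← hx, ← hy]
  | smul a x _ hx => rw [map_smul, smul_eq_mul, mul_smul, ← hx]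

end ExteriorPower

section Theta

variable {m : ℕ}

/-- The element `ι_y (e₁ ∧ ⋯ ∧ e_m)` for the covector with coordinates `u`. -/
noncomputable def covTop (m : ℕ) : (Fin m → K) →ₗ[K] ExtAlg K m where
  toFun u := ctr K (∑ j, u j • (LinearMap.proj j : (Fin m → K) →ₗ[K] K)) (topWedge K m)
  map_add' u v := by
    simp [add_smul, Finset.sum_add_distrib, ctr_add]
  map_smul' c u := by
    simp [mul_smul, ← Finset.smul_sum, ctr_smul]

lemma covTop_apply (u : Fin m → K) :
    covTop K m u = ∑ l, u l • ctr K (LinearMap.proj l) (topWedge K m) := by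
  simp [covTop, ctr_sum, ctr_smul]

lemma covTop_mem (u : Fin m → K) : covTop K m u ∈ ⋀[K]^(m - 1) (Fin m → K) :=
  ctr_mem K _ (topWedge_mem K)

lemma wmul_covTop (v u : Fin m → K) :
    wmul K v (covTop K m u) = (u ⬝ᵥ v) • topWedge K m := by
  simp only [covTop, LinearMap.coe_mk, AddHom.coe_mk]
  rw [wmul_ctr, wmul_topWedge]
  simp [dotProduct]

lemma topCoeff_wmul_covTop (l : Fin m) (u : Fin m → K) :
    topCoeff K m (wmul K (Pi.single l 1) (covTop K m u)) = u l := by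
  simp [wmul_covTop, topCoeff_topWedge]

lemma eq_covTop (hm : 0 < m) {ω : ExtAlg K m} (h : ω ∈ ⋀[K]^(m - 1) (Fin m → K)) :
    ω = covTop K m (fun l => topCoeff K m (wmul K (Pi.single l 1) ω)) := by
  have h1 := sum_ctr_wmul K h
  rw [Nat.cast_sub hm, Nat.cast_one, sub_sub_cancel, one_smul] at h1
  conv_lhs => rw [← h1]
  rw [covTop_apply]
  refine Finset.sum_congr rfl fun l _ => ?_
  have h2 := wmul_mem K (Pi.single l 1) h
  rw [Nat.sub_add_cancel hm] at h2
  conv_lhs => rw [eq_topCoeff_smul K h2, map_smul]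

lemma theta_apply (a : Matrix (Fin m) (Fin m) K) (ω : ExtAlg K m) :
    theta K a ω = ∑ i, ∑ j, a i j • wmul K (Pi.single i 1) (ctr K (LinearMap.proj j) ω) := by
  simp [theta, LinearMap.sum_apply]

lemma theta_add (a b : Matrix (Fin m) (Fin m) K) :
    theta K (a + b) = theta K a + theta K b := by
  simp [theta, add_smul, Finset.sum_add_distrib]

lemma theta_zero : theta K (0 : Matrix (Fin m) (Fin m) K) = 0 := by
  simp [theta]

lemma theta_one {k : ℕ} {ω : ExtAlg K m} (h : ω ∈ ⋀[K]^k (Fin m → K)) :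
    theta K 1 ω = (k : K) • ω := by
  rw [theta_apply, ← euler K h]
  simp [Matrix.one_apply]

lemma theta_covTop (a : Matrix (Fin m) (Fin m) K) (u : Fin m → K) :
    theta K a (covTop K m u) = a.trace • covTop K m u - covTop K m (u ᵥ* a) := by
  have h : ∀ i j, wmul K (Pi.single i 1) (ctr K (LinearMap.proj j) (covTop K m u))
      = (if i = j then covTop K m u else 0) - u i • ctr K (LinearMap.proj j) (topWedge K m) := by
    intro i j
    rw [wmul_ctr, wmul_covTop, map_smul]
    simp [Pi.single_apply, eq_comm, ite_smul]
  simp only [theta_apply, h, smul_sub, Finset.sum_sub_distrib]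
  congr 1
  · simp [Matrix.trace, Finset.sum_smul]
  · rw [covTop_apply, Finset.sum_comm]
    refine Finset.sum_congr rfl fun j _ => ?_
    simp only [Matrix.vecMul, dotProduct, Finset.sum_smul, smul_smul]
    exact Finset.sum_congr rfl fun i _ => by rw [mul_comm]

end Theta

section Rho

variable {m : ℕ}

/-- The lower-left row of `A ∈ gl(m|1)` as a vector. -/
def rowy (A : gl K m 1) : Fin m → K := fun j => A (Fin.last m) (Fin.castSucc j)

lemma ctr_blky_topWedge (A : gl K m 1) :
    ctr K (blky K A) (topWedge K m) = covTop K m (rowy K A) := rfl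

lemma blka_add (A B : gl K m 1) : blka K (A + B) = blka K A + blka K B := rfl
lemma blka_smul (c : K) (A : gl K m 1) : blka K (c • A) = c • blka K A := rfl
lemma blkx_add (A B : gl K m 1) : blkx K (A + B) = blkx K A + blkx K B := rfl
lemma blkx_smul (c : K) (A : gl K m 1) : blkx K (c • A) = c • blkx K A := rfl
lemma blkd_add (A B : gl K m 1) : blkd K (A + B) = blkd K A + blkd K B := rfl
lemma blkd_smul (c : K) (A : gl K m 1) : blkd K (c • A) = c * blkd K A := rfl
lemma rowy_add (A B : gl K m 1) : rowy K (A + B) = rowy K A + rowy K B := rfl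
lemma rowy_smul (c : K) (A : gl K m 1) : rowy K (c • A) = c • rowy K A := rfl
lemma blky_add (A B : gl K m 1) : blky K (A + B) = blky K A + blky K B := by
  simp [blky, add_smul, Finset.sum_add_distrib]
lemma rho_apply (A : gl K m 1) (v : Wam K m) (r : Fin m) :
    rho K A v r = theta K (blka K A) (v r) - (blka K A).trace • v r
      + (((r : ℕ) + 1 : K) * blkd K A) • v r
      + (if h : (r : ℕ) + 1 < m then ((r : ℕ) + 1 : K) • wmul K (blkx K A) (v ⟨r + 1, h⟩) else 0)
      + (if _h : 0 < (r : ℕ) then ctr K (blky K A)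
          (v ⟨(r : ℕ) - 1, lt_of_le_of_lt (Nat.sub_le _ 1) r.isLt⟩) else 0) := by
  simp only [rho, rhoComp, LinearMap.pi_apply]
  split_ifs <;> simp

lemma rho_add (A B : gl K m 1) : rho K (A + B) = rho K A + rho K B := by
  refine LinearMap.ext fun v => funext fun r => ?_
  simp only [LinearMap.add_apply, Pi.add_apply, rho_apply, blka_add, blkx_add, blkd_add, blky_add,
    theta_add, wmul_add, ctr_add, Matrix.trace_add]
  split_ifs <;> module

end Rho

section Grading

variable {m : ℕ}

lemma sg_zero : sg K 0 = 1 := if_pos rfl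

lemma sg_one : sg K 1 = -1 := if_neg (by decide)

lemma zmod_two_cases (p : ZMod 2) : p = 0 ∨ p = 1 := by
  revert p; decide

lemma sg_add (p q : ZMod 2) : sg K (p + q) = sg K p * sg K q := by
  rcases zmod_two_cases p with rfl | rfl <;> rcases zmod_two_cases q with rfl | rfl <;>
    simp [sg_zero, sg_one, show (1 : ZMod 2) + 1 = 0 from rfl]

lemma sg_mul_self (p : ZMod 2) : sg K p * sg K p = 1 := by
  rcases zmod_two_cases p with rfl | rfl <;> simp [sg_zero, sg_one]

/-- The eigenvalue of the grading element on the `i`-th basis vector. -/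
def eps (i : Fin (m + 1)) : ℤ := if (i : ℕ) < m then 1 else 0

lemma eps_castSucc (i : Fin m) : eps (Fin.castSucc i) = 1 := by simp [eps]

lemma eps_last : eps (Fin.last m) = 0 := by simp [eps]

/-- `A` has weight `w` for the `ℤ`-grading of `gl(m|1)` in which the upper-right block
has weight `1` and the lower-left block has weight `-1`. -/
def HasWt (w : ℤ) (A : gl K m 1) : Prop := ∀ i j, A i j ≠ 0 → eps i - eps j = w

variable {K}

lemma HasWt.isHom {w : ℤ} {A : gl K m 1} (h : HasWt K w A) : IsHom K (w : ZMod 2) A := by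
  intro i j hij
  rw [← h i j hij]
  unfold par eps
  split_ifs <;> (simp; try decide)

lemma HasWt.add {w : ℤ} {A B : gl K m 1} (hA : HasWt K w A) (hB : HasWt K w B) :
    HasWt K w (A + B) := by
  intro i j hij
  by_contra hne
  have h1 : A i j = 0 := by_contra fun h => hne (hA i j h)
  have h2 : B i j = 0 := by_contra fun h => hne (hB i j h)
  exact hij (by simp [h1, h2])

lemma HasWt.smul {w : ℤ} {A : gl K m 1} (c : K) (hA : HasWt K w A) : HasWt K w (c • A) :=
  fun i j hij => hA i j fun h => hij (by simp [h])

lemma HasWt.sub {w : ℤ} {A B : gl K m 1} (hA : HasWt K w A) (hB : HasWt K w B) :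
    HasWt K w (A - B) := by
  have := hA.add (hB.smul (-1))
  rwa [neg_one_smul, ← sub_eq_add_neg] at this

lemma HasWt.mul {w z : ℤ} {A B : gl K m 1} (hA : HasWt K w A) (hB : HasWt K z B) :
    HasWt K (w + z) (A * B) := by
  intro i j hij
  rw [Matrix.mul_apply] at hij
  obtain ⟨k, -, hk⟩ := Finset.exists_ne_zero_of_sum_ne_zero hij
  have h1 := hA i k (left_ne_zero_of_mul hk)
  have h2 := hB k j (right_ne_zero_of_mul hk)
  omega

lemma evenP_of_isHom {p : ZMod 2} {A : gl K m 1} (h : IsHom K p A) :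
    evenP K A = if p = 0 then A else 0 := by
  ext i j
  by_cases h0 : A i j = 0
  · split_ifs <;> simp [evenP, h0]
  · have h1 := h i j h0
    rcases zmod_two_cases p with rfl | rfl
    · have : par m 1 i = par m 1 j := by
        revert h1; generalize par m 1 i = a; generalize par m 1 j = b; revert a b; decide
      simp [evenP, this]
    · have : par m 1 i ≠ par m 1 j := by
        revert h1; generalize par m 1 i = a; generalize par m 1 j = b; revert a b; decide
      simp [evenP, this]

lemma oddP_of_isHom {p : ZMod 2} {A : gl K m 1} (h : IsHom K p A) :
    oddP K A = if p = 0 then 0 else A := by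
  ext i j
  have h1 : oddP K A i j = A i j - evenP K A i j := by
    by_cases h : par m 1 i = par m 1 j <;> simp [oddP, evenP, h]
  rw [h1, evenP_of_isHom h]
  split_ifs <;> simp

lemma sbr_eq {p q : ZMod 2} {A B : gl K m 1} (hA : IsHom K p A) (hB : IsHom K q B) :
    sbr K A B = A * B - sg K (p * q) • (B * A) := by
  rw [sbr, evenP_of_isHom hA, evenP_of_isHom hB, oddP_of_isHom hA, oddP_of_isHom hB]
  rcases zmod_two_cases p with rfl | rfl <;> rcases zmod_two_cases q with rfl | rfl <;>
    simp [sg_zero, sg_one]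

lemma HasWt.sbr {w z : ℤ} {A B : gl K m 1} (hA : HasWt K w A) (hB : HasWt K z B) :
    HasWt K (w + z) (sbr K A B) := by
  rw [sbr_eq hA.isHom hB.isHom]
  refine (hA.mul hB).sub (HasWt.smul _ ?_)
  rw [add_comm]
  exact hB.mul hA

variable (K) in
/-- The projection of `gl(m|1)` onto its weight-`w` part. -/
def wtProj (w : ℤ) : gl K m 1 →ₗ[K] gl K m 1 where
  toFun A := Matrix.of fun i j => if eps i - eps j = w then A i j else 0
  map_add' A B := by ext i j; by_cases h : eps i - eps j = w <;> simp [h]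
  map_smul' c A := by ext i j; by_cases h : eps i - eps j = w <;> simp [h]

lemma wtProj_apply (w : ℤ) (A : gl K m 1) (i j : Fin (m + 1)) :
    wtProj K w A i j = if eps i - eps j = w then A i j else 0 := rfl

lemma hasWt_wtProj (w : ℤ) (A : gl K m 1) : HasWt K w (wtProj K w A) := by
  intro i j hij
  by_contra h
  exact hij (by rw [wtProj_apply, if_neg h])

lemma wtProj_of_hasWt {w : ℤ} {A : gl K m 1} (h : HasWt K w A) (z : ℤ) :
    wtProj K z A = if w = z then A else 0 := by
  ext i j
  by_cases h0 : A i j = 0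
  · split_ifs <;> simp [wtProj_apply, h0]
  · rw [wtProj_apply, h i j h0]
    split_ifs <;> simp

lemma IsHom.wtProj {p : ZMod 2} {A : gl K m 1} (h : IsHom K p A) (w : ℤ) :
    IsHom K p (wtProj K w A) := by
  intro i j hij
  refine h i j fun h0 => hij ?_
  rw [wtProj_apply, h0, ite_self]

lemma sum_wtProj (A : gl K m 1) : A = wtProj K (-1) A + wtProj K 0 A + wtProj K 1 A := by
  ext i j
  simp only [Matrix.add_apply, wtProj_apply]
  unfold eps
  split_ifs <;> first | omega | simp

lemma HasWt.blka_eq_zero {w : ℤ} {A : gl K m 1} (h : HasWt K w A) (hw : w ≠ 0) :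
    blka K A = 0 := by
  ext i j
  by_contra h0
  have := h _ _ h0
  simp only [eps_castSucc] at this
  omega

lemma HasWt.blkd_eq_zero {w : ℤ} {A : gl K m 1} (h : HasWt K w A) (hw : w ≠ 0) :
    blkd K A = 0 := by
  by_contra h0
  have := h _ _ h0
  omega

lemma HasWt.blkx_eq_zero {w : ℤ} {A : gl K m 1} (h : HasWt K w A) (hw : w ≠ 1) :
    blkx K A = 0 := by
  ext i
  by_contra h0
  have := h _ _ h0
  rw [eps_castSucc, eps_last] at this
  omega

lemma HasWt.rowy_eq_zero {w : ℤ} {A : gl K m 1} (h : HasWt K w A) (hw : w ≠ -1) :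
    rowy K A = 0 := by
  ext i
  by_contra h0
  have := h _ _ h0
  rw [eps_castSucc, eps_last] at this
  omega

lemma blky_eq_zero {A : gl K m 1} (h : rowy K A = 0) : blky K A = 0 :=
  Finset.sum_eq_zero fun j _ => by
    rw [show A (Fin.last m) (Fin.castSucc j) = 0 from congrFun h j, zero_smul]

variable (K) in
/-- The element `diag(1, …, 1 | 0)` defining the grading. -/
def gradeElt (m : ℕ) : gl K m 1 := Matrix.diagonal fun i => ((eps i : ℤ) : K)

lemma hasWt_gradeElt : HasWt K 0 (gradeElt K m) := by
  intro i j hij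
  by_cases h : i = j
  · simp [h]
  · exact absurd (Matrix.diagonal_apply_ne _ h) hij

lemma sbr_gradeElt {w : ℤ} {A : gl K m 1} (h : HasWt K w A) :
    sbr K (gradeElt K m) A = (w : K) • A := by
  rw [sbr_eq hasWt_gradeElt.isHom h.isHom]
  simp only [Int.cast_zero, zero_mul, sg_zero, one_smul]
  ext i j
  rw [Matrix.sub_apply, gradeElt, Matrix.diagonal_mul, Matrix.mul_diagonal, Matrix.smul_apply]
  by_cases h0 : A i j = 0
  · simp [h0]
  · rw [← h i j h0]
    push_cast
    simp only [smul_eq_mul]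
    ring

lemma rho_gradeElt {r : Fin m} {v : Wam K m} (h : v r ∈ ⋀[K]^(m - 1 - (r : ℕ)) (Fin m → K)) :
    rho K (gradeElt K m) v r = (((-1 - (r : ℕ) : ℤ)) : K) • v r := by
  have ha : blka K (gradeElt K m) = 1 := by
    ext i j
    simp [blka, gradeElt, Matrix.diagonal_apply, Matrix.one_apply, eps]
  have hd : blkd K (gradeElt K m) = 0 := by simp [blkd, gradeElt, eps]
  have hx := (hasWt_gradeElt (K := K) (m := m)).blkx_eq_zero (by decide)
  have hy := blky_eq_zero ((hasWt_gradeElt (K := K) (m := m)).rowy_eq_zero (by decide))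
  have h0 : wmul K (0 : Fin m → K) = 0 := by simpa using wmul_smul K (0 : K) (0 : Fin m → K)
  rw [rho_apply, ha, hd, hx, hy, theta_one K h, ctr_zero, h0]
  have h1 : ((m - 1 - (r : ℕ) : ℕ) : K) = m - 1 - (r : ℕ) := by
    have := r.isLt
    rw [Nat.cast_sub (by omega), Nat.cast_sub (by omega), Nat.cast_one]
  rw [h1]
  simp only [Matrix.trace_one, Fintype.card_fin, LinearMap.zero_apply, smul_zero, dite_eq_ite,
    ite_self, mul_zero, zero_smul, add_zero]
  push_cast
  module

lemma wmul_zero : wmul K (0 : Fin m → K) = 0 := by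
  simpa using wmul_smul K (0 : K) (0 : Fin m → K)

/-- An element of weight `w` maps slot `r + w` to slot `r`. -/
lemma HasWt.rho_congr {w : ℤ} {A : gl K m 1} (hA : HasWt K w A) {u v : Wam K m} {r : Fin m}
    (c : K) (h : ∀ s : Fin m, (s : ℤ) = r + w → v s = c • u s) :
    rho K A v r = c • rho K A u r := by
  have e1 : theta K (blka K A) (v r) - (blka K A).trace • v r
      + (((r : ℕ) + 1 : K) * blkd K A) • v r = c • (theta K (blka K A) (u r)
        - (blka K A).trace • u r + (((r : ℕ) + 1 : K) * blkd K A) • u r) := by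
    by_cases hw : w = 0
    · rw [h r (by omega), map_smul]; module
    · simp [hA.blka_eq_zero hw, hA.blkd_eq_zero hw, theta_zero]
  have e2 : (if h : (r : ℕ) + 1 < m then
        ((r : ℕ) + 1 : K) • wmul K (blkx K A) (v ⟨r + 1, h⟩) else 0)
      = c • (if h : (r : ℕ) + 1 < m then
        ((r : ℕ) + 1 : K) • wmul K (blkx K A) (u ⟨r + 1, h⟩) else 0) := by
    split_ifs with hr
    · by_cases hw : w = 1
      · rw [h ⟨r + 1, hr⟩ (by simp [hw]), map_smul, smul_comm]
      · simp [hA.blkx_eq_zero hw, wmul_zero]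
    · simp
  have e3 : (if _h : 0 < (r : ℕ) then ctr K (blky K A)
          (v ⟨(r : ℕ) - 1, lt_of_le_of_lt (Nat.sub_le _ 1) r.isLt⟩) else 0)
      = c • (if _h : 0 < (r : ℕ) then ctr K (blky K A)
          (u ⟨(r : ℕ) - 1, lt_of_le_of_lt (Nat.sub_le _ 1) r.isLt⟩) else 0) := by
    split_ifs with hr
    · by_cases hw : w = -1
      · rw [h ⟨r - 1, _⟩ (by simp [hw]; omega), map_smul]
      · simp [blky_eq_zero (hA.rowy_eq_zero hw), ctr_zero]
    · simp
  rw [rho_apply, rho_apply, e1, e2, e3]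
  module

lemma HasWt.rho_eq_zero {w : ℤ} {A : gl K m 1} (hA : HasWt K w A) {v : Wam K m} {r : Fin m}
    (h : ∀ s : Fin m, (s : ℤ) = r + w → v s = 0) : rho K A v r = 0 := by
  have := hA.rho_congr (u := 0) (v := v) (r := r) 0 fun s hs => by simp [h s hs]
  simpa using this

end Grading

section Bracket

variable {m : ℕ} {K}

lemma IsHom.hasWt_zero {A : gl K m 1} (h : IsHom K 0 A) : HasWt K 0 A := by
  intro i j hij
  have := h i j hij
  unfold par at this
  unfold eps
  split_ifs at this ⊢ <;> first | rfl | (exact absurd this (by decide))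

lemma HasWt.isHom_zero {A : gl K m 1} (h : HasWt K 0 A) : IsHom K 0 A := by
  simpa using h.isHom

lemma HasWt.isHom_one {A : gl K m 1} (h : HasWt K 1 A) : IsHom K 1 A := by
  simpa using h.isHom

lemma HasWt.isHom_neg_one {A : gl K m 1} (h : HasWt K (-1) A) : IsHom K 1 A := by
  simpa using h.isHom

lemma IsHom.apply_eq_zero {p : ZMod 2} {A : gl K m 1} (h : IsHom K p A) {i j : Fin (m + 1)}
    (hij : par m 1 i + par m 1 j ≠ p) : A i j = 0 :=
  by_contra fun h0 => hij (h i j h0)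

lemma par_castSucc (i : Fin m) : par m 1 (Fin.castSucc i) = 0 := by simp [par]

lemma par_last : par m 1 (Fin.last m) = 1 := by simp [par]

lemma IsHom.blka_eq_zero {A : gl K m 1} (h : IsHom K 1 A) : blka K A = 0 := by
  ext i j
  exact h.apply_eq_zero (by rw [par_castSucc, par_castSucc]; decide)

lemma IsHom.blkd_eq_zero {A : gl K m 1} (h : IsHom K 1 A) : blkd K A = 0 :=
  h.apply_eq_zero (by rw [par_last]; decide)

lemma str_eq (A : gl K m 1) : str K A = (blka K A).trace - blkd K A := by
  rw [str, Fin.sum_univ_castSucc, par_last, sg_one]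
  simp only [par_castSucc, sg_zero]
  simp [Matrix.trace, blka, blkd, sub_eq_add_neg]

lemma str_add (A B : gl K m 1) : str K (A + B) = str K A + str K B := by
  rw [str_eq, str_eq, str_eq, blka_add, blkd_add, Matrix.trace_add]; ring

lemma str_smul (c : K) (A : gl K m 1) : str K (c • A) = c * str K A := by
  rw [str_eq, str_eq, blka_smul, blkd_smul, Matrix.trace_smul, smul_eq_mul]; ring

lemma IsHom.str_eq_zero {A : gl K m 1} (h : IsHom K 1 A) : str K A = 0 := by
  rw [str_eq, h.blka_eq_zero, h.blkd_eq_zero, Matrix.trace_zero, sub_zero]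

lemma HasWt.str_eq_zero {w : ℤ} {A : gl K m 1} (h : HasWt K w A) (hw : w ≠ 0) :
    str K A = 0 := by
  rw [str_eq, h.blka_eq_zero hw, h.blkd_eq_zero hw, Matrix.trace_zero, sub_zero]

lemma str_sbr {p q : ZMod 2} {A B : gl K m 1} (hA : IsHom K p A) (hB : IsHom K q B) :
    str K (sbr K A B) = 0 := by
  rw [sbr_eq hA hB, str]
  simp only [Matrix.sub_apply, Matrix.smul_apply, Matrix.mul_apply, mul_sub, smul_eq_mul,
    Finset.mul_sum, Finset.sum_sub_distrib]
  rw [sub_eq_zero]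
  conv_rhs => rw [Finset.sum_comm]
  refine Finset.sum_congr rfl fun i _ => Finset.sum_congr rfl fun k _ => ?_
  by_cases h1 : A i k = 0
  · simp [h1]
  by_cases h2 : B k i = 0
  · simp [h2]
  have h3 : sg K (par m 1 i) = sg K (par m 1 k) * sg K (p * q) := by
    rw [← sg_add, ← hA i k h1, ← hB k i h2]
    congr 1
    generalize par m 1 i = a; generalize par m 1 k = b; revert a b; decide
  rw [h3]; ring

lemma HasWt.eq_zero {w : ℤ} {A : gl K m 1} (h : HasWt K w A) (h1 : w ≠ -1) (h2 : w ≠ 0)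
    (h3 : w ≠ 1) : A = 0 := by
  rw [sum_wtProj A, wtProj_of_hasWt h, wtProj_of_hasWt h, wtProj_of_hasWt h]
  simp [h1, h2, h3]

lemma IsHom.sbr {p q : ZMod 2} {A B : gl K m 1} (hA : IsHom K p A) (hB : IsHom K q B) :
    IsHom K (p + q) (sbr K A B) := by
  have mul : ∀ {p q : ZMod 2} {A B : gl K m 1}, IsHom K p A → IsHom K q B →
      IsHom K (p + q) (A * B) := by
    intro p q A B hA hB i j hij
    rw [Matrix.mul_apply] at hij
    obtain ⟨k, -, hk⟩ := Finset.exists_ne_zero_of_sum_ne_zero hij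
    rw [← hA i k (left_ne_zero_of_mul hk), ← hB k j (right_ne_zero_of_mul hk)]
    generalize par m 1 i = a; generalize par m 1 k = b; generalize par m 1 j = c
    revert a b c; decide
  intro i j hij
  rw [sbr_eq hA hB, Matrix.sub_apply, Matrix.smul_apply] at hij
  by_cases h : (A * B) i j = 0
  · rw [h, zero_sub, neg_ne_zero] at hij
    rw [add_comm p q]
    exact mul hB hA i j (right_ne_zero_of_mul hij)
  · exact mul hA hB i j h

lemma sbr_of_hasWt_zero {q : ZMod 2} {A B : gl K m 1} (hA : HasWt K 0 A) (hB : IsHom K q B) :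
    sbr K A B = A * B - B * A := by
  rw [sbr_eq hA.isHom_zero hB, zero_mul, sg_zero, one_smul]

lemma rowy_sbr {q : ZMod 2} {A B : gl K m 1} (hA : HasWt K 0 A) (hB : IsHom K q B) :
    rowy K (sbr K A B) = blkd K A • rowy K B - rowy K B ᵥ* blka K A := by
  have hy := hA.rowy_eq_zero (by decide)
  rw [sbr_of_hasWt_zero hA hB]
  ext j
  have hyj : ∀ j, A (Fin.last m) (Fin.castSucc j) = 0 := congrFun hy
  simp only [rowy, Matrix.sub_apply, Matrix.mul_apply, Pi.sub_apply, Pi.smul_apply]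
  rw [Fin.sum_univ_castSucc, Fin.sum_univ_castSucc]
  simp [hyj, blkd, blka, Matrix.vecMul, dotProduct, rowy]

lemma blka_sbr {A B : gl K m 1} (hA : HasWt K 0 A) (hB : HasWt K 0 B) :
    blka K (sbr K A B) = blka K A * blka K B - blka K B * blka K A := by
  have hA' : ∀ j, A (Fin.castSucc j) (Fin.last m) = 0 :=
    congrFun (hA.blkx_eq_zero (by decide))
  have hB' : ∀ j, B (Fin.castSucc j) (Fin.last m) = 0 :=
    congrFun (hB.blkx_eq_zero (by decide))
  rw [sbr_of_hasWt_zero hA hB.isHom]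
  ext i j
  simp only [blka, Matrix.sub_apply, Matrix.mul_apply, Matrix.of_apply]
  rw [Fin.sum_univ_castSucc, Fin.sum_univ_castSucc]
  simp [hA', hB']

lemma sbr_one_neg_one {A B : gl K m 1} (hA : HasWt K 1 A) (hB : HasWt K (-1) B) :
    sbr K A B = A * B + B * A := by
  rw [sbr_eq hA.isHom_one hB.isHom_neg_one, one_mul, sg_one, neg_one_smul, sub_neg_eq_add]

lemma blka_sbr_one_neg_one {A B : gl K m 1} (hA : HasWt K 1 A) (hB : HasWt K (-1) B) :
    blka K (sbr K A B) = Matrix.vecMulVec (blkx K A) (rowy K B) := by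
  have hA' : ∀ i j, A (Fin.castSucc i) (Fin.castSucc j) = 0 := fun i j =>
    congrFun (congrFun (hA.blka_eq_zero (by decide)) i) j
  have hB' : ∀ j, B (Fin.castSucc j) (Fin.last m) = 0 :=
    congrFun (hB.blkx_eq_zero (by decide))
  rw [sbr_one_neg_one hA hB]
  ext i j
  simp only [blka, Matrix.add_apply, Matrix.mul_apply, Matrix.of_apply, Matrix.vecMulVec_apply]
  rw [Fin.sum_univ_castSucc, Fin.sum_univ_castSucc]
  simp [hA', hB', blkx, rowy]

lemma blkd_sbr_one_neg_one {A B : gl K m 1} (hA : HasWt K 1 A) (hB : HasWt K (-1) B) :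
    blkd K (sbr K A B) = rowy K B ⬝ᵥ blkx K A := by
  have hA' : ∀ j, A (Fin.last m) j = 0 := by
    intro j
    by_contra h0
    have := hA _ _ h0
    unfold eps at this
    split_ifs at this <;> simp_all
  have hB' : B (Fin.last m) (Fin.last m) = 0 := hB.blkd_eq_zero (by decide)
  rw [sbr_one_neg_one hA hB]
  simp only [blkd, Matrix.add_apply, Matrix.mul_apply]
  rw [Fin.sum_univ_castSucc, Fin.sum_univ_castSucc]
  simp [hA', hB', blkx, rowy, dotProduct]

/-- The weight-zero part acts on slot `0` as on the lower-left block. -/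
lemma rho_covTop (hm : 0 < m) {A : gl K m 1} (hA : HasWt K 0 A) {v : Wam K m} {u : Fin m → K}
    (hv : v ⟨0, hm⟩ = covTop K m u) :
    rho K A v ⟨0, hm⟩ = covTop K m (blkd K A • u - u ᵥ* blka K A) := by
  have hx := hA.blkx_eq_zero (by decide)
  rw [rho_apply, hv, hx, wmul_zero, theta_covTop]
  simp only [LinearMap.zero_apply, smul_zero, dite_eq_ite, ite_self, lt_irrefl,
    map_sub, map_smul]
  simp [neg_add_eq_sub]

lemma sbr_add_left (A A' B : gl K m 1) : sbr K (A + A') B = sbr K A B + sbr K A' B := by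
  have h1 : evenP K (A + A') = evenP K A + evenP K A' := by
    ext i j; by_cases h : par m 1 i = par m 1 j <;> simp [evenP, h]
  have h2 : oddP K (A + A') = oddP K A + oddP K A' := by
    ext i j; by_cases h : par m 1 i = par m 1 j <;> simp [oddP, h]
  simp only [sbr, h1, h2, add_mul, mul_add]
  abel

lemma sbr_add_right (A B B' : gl K m 1) : sbr K A (B + B') = sbr K A B + sbr K A B' := by
  have h1 : evenP K (B + B') = evenP K B + evenP K B' := by
    ext i j; by_cases h : par m 1 i = par m 1 j <;> simp [evenP, h]
  have h2 : oddP K (B + B') = oddP K B + oddP K B' := by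
    ext i j; by_cases h : par m 1 i = par m 1 j <;> simp [oddP, h]
  simp only [sbr, h1, h2, add_mul, mul_add]
  abel

end Bracket

section GCocycle

variable {m : ℕ} {K}

variable (K) in
/-- The action of `A` on `e₁ ∧ ⋯ ∧ e_m` in the Kac module containing `V`. -/
noncomputable def topAct (hm : 0 < m) (A : gl K m 1) : Wam K m :=
  Pi.single (⟨0, hm⟩ : Fin m) (covTop K m (rowy K A))

lemma gV_eq (hm : 0 < m) (A B : gl K m 1) :
    gV K m hm A B = str K A • topAct K hm B - str K B • topAct K hm A := by
  rw [gV, ctr_blky_topWedge, ctr_blky_topWedge, topAct, topAct, Pi.single_sub, Pi.single_smul,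
    Pi.single_smul]

lemma topAct_add (hm : 0 < m) (A B : gl K m 1) :
    topAct K hm (A + B) = topAct K hm A + topAct K hm B := by
  rw [topAct, rowy_add, map_add, Pi.single_add]; rfl

lemma topAct_smul (hm : 0 < m) (c : K) (A : gl K m 1) :
    topAct K hm (c • A) = c • topAct K hm A := by
  rw [topAct, rowy_smul, map_smul, Pi.single_smul]; rfl

lemma topAct_of_rowy_eq_zero (hm : 0 < m) {A : gl K m 1} (h : rowy K A = 0) :
    topAct K hm A = 0 := by
  rw [topAct, h, map_zero, Pi.single_zero]

lemma topAct_even (hm : 0 < m) {A : gl K m 1} (h : IsHom K 0 A) : topAct K hm A = 0 :=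
  topAct_of_rowy_eq_zero hm (h.hasWt_zero.rowy_eq_zero (by decide))

lemma rho_topAct_even_odd (hm : 0 < m) {A B : gl K m 1} (hA : IsHom K 0 A) (hB : IsHom K 1 B) :
    rho K A (topAct K hm B) = topAct K hm (sbr K A B) := by
  ext1 r
  by_cases hr : r = ⟨0, hm⟩
  · subst hr
    rw [rho_covTop hm hA.hasWt_zero (v := topAct K hm B) (Pi.single_eq_same _ _), topAct,
      Pi.single_eq_same, rowy_sbr hA.hasWt_zero hB]
  · rw [topAct, topAct, Pi.single_eq_of_ne hr]
    refine hA.hasWt_zero.rho_eq_zero fun s hs => Pi.single_eq_of_ne ?_ _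
    rwa [show s = r from Fin.ext (by omega)]

lemma sbr_swap_even {q : ZMod 2} {A B : gl K m 1} (hA : IsHom K 0 A) (hB : IsHom K q B) :
    sbr K B A = -sbr K A B := by
  rw [sbr_eq hA hB, sbr_eq hB hA]; simp [sg_zero]

lemma rho_topAct_odd_odd (hm : 0 < m) {A B : gl K m 1} (hA : IsHom K 1 A) (hB : IsHom K 1 B) :
    rho K A (topAct K hm B) + rho K B (topAct K hm A) = 0 := by
  have key : ∀ {A B : gl K m 1}, IsHom K 1 A → ∀ r, rho K A (topAct K hm B) r
      = if (r : ℕ) = 1 then ctr K (blky K A) (covTop K m (rowy K B)) else 0 := by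
    intro A B hA r
    rw [rho_apply, hA.blka_eq_zero, hA.blkd_eq_zero, theta_zero]
    have h1 : (if h : (r : ℕ) + 1 < m then
        ((r : ℕ) + 1 : K) • wmul K (blkx K A) (topAct K hm B ⟨r + 1, h⟩) else 0) = 0 := by
      split_ifs with h
      · rw [topAct, Pi.single_eq_of_ne (by simp [Fin.ext_iff])]; simp
      · rfl
    rw [h1]
    simp only [LinearMap.zero_apply, Matrix.trace_zero, zero_smul, mul_zero, sub_zero, add_zero,
      zero_add]
    split_ifs with h2 h3 h3
    · have h4 : (⟨(r : ℕ) - 1, lt_of_le_of_lt (Nat.sub_le _ 1) r.isLt⟩ : Fin m) = ⟨0, hm⟩ := by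
        simp [h3]
      rw [h4, topAct, Pi.single_eq_same]
    · rw [topAct, Pi.single_eq_of_ne (by simp [Fin.ext_iff]; omega), map_zero]
    · omega
    · rfl
  ext1 r
  rw [Pi.add_apply, key hA, key hB, ← ctr_blky_topWedge, ← ctr_blky_topWedge]
  split_ifs
  · rw [ctr_ctr, neg_add_cancel]; rfl
  · simp

lemma gV_cocycle (hm : 0 < m) {p pA pB pC : ZMod 2} {A B C : gl K m 1}
    (hA : IsHom K pA A) (hB : IsHom K pB B) (hC : IsHom K pC C) :
    sg K (p * pA) • rho K A (gV K m hm B C)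
      - sg K (pA * pB + p * pB) • rho K B (gV K m hm A C)
      + sg K ((pA + pB) * pC + p * pC) • rho K C (gV K m hm A B)
      - gV K m hm (sbr K A B) C + sg K (pB * pC) • gV K m hm (sbr K A C) B
      + gV K m hm A (sbr K B C) = 0 := by
  simp only [gV_eq, str_sbr hA hB, str_sbr hA hC, str_sbr hB hC, map_sub, map_smul]
  have hneg : ∀ A : gl K m 1, topAct K hm (-A) = -topAct K hm A := fun A => by
    simpa using topAct_smul hm (-1 : K) A
  have heven : ∀ {A B : gl K m 1}, IsHom K 1 A → IsHom K 1 B →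
      topAct K hm (sbr K A B) = 0 := fun hA hB => topAct_even hm (hA.sbr hB)
  have heven' : ∀ {A B : gl K m 1}, IsHom K 0 A → IsHom K 0 B →
      topAct K hm (sbr K A B) = 0 := fun hA hB => topAct_even hm (by simpa using hA.sbr hB)
  rcases zmod_two_cases pA with rfl | rfl <;> rcases zmod_two_cases pB with rfl | rfl <;>
    rcases zmod_two_cases pC with rfl | rfl
  · simp [topAct_even hm hA, topAct_even hm hB, topAct_even hm hC, heven' hA hB, heven' hA hC,
      heven' hB hC]
  · simp only [topAct_even hm hA, topAct_even hm hB, hC.str_eq_zero, rho_topAct_even_odd hm hA hC,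
      rho_topAct_even_odd hm hB hC, heven' hA hB]
    simp [sg_zero]
    abel
  · simp only [topAct_even hm hA, topAct_even hm hC, hB.str_eq_zero, rho_topAct_even_odd hm hA hB,
      sbr_swap_even hC hB, hneg, rho_topAct_even_odd hm hC hB, heven' hA hC]
    simp [sg_zero]
  · have h := rho_topAct_odd_odd hm hB hC
    rw [add_comm, add_eq_zero_iff_eq_neg] at h
    simp only [topAct_even hm hA, hB.str_eq_zero, hC.str_eq_zero, heven hB hC, h]
    simp [sg_zero, sg_one, sg_add]
  · simp only [topAct_even hm hB, topAct_even hm hC, hA.str_eq_zero, sbr_swap_even hB hA,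
      sbr_swap_even hC hA, hneg, rho_topAct_even_odd hm hC hA, rho_topAct_even_odd hm hB hA,
      heven' hB hC]
    simp [sg_zero]
  · have h := rho_topAct_odd_odd hm hA hC
    rw [add_comm, add_eq_zero_iff_eq_neg] at h
    simp only [topAct_even hm hB, hA.str_eq_zero, hC.str_eq_zero, heven hA hC, h]
    simp [sg_zero, sg_one, sg_add]
  · have h := rho_topAct_odd_odd hm hA hB
    rw [add_comm, add_eq_zero_iff_eq_neg] at h
    simp only [topAct_even hm hC, hA.str_eq_zero, hB.str_eq_zero, heven hA hB, h]
    simp [sg_zero, sg_one, sg_add]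
  · simp [hA.str_eq_zero, hB.str_eq_zero, hC.str_eq_zero]

end GCocycle

section Casimir

variable {m : ℕ} {K}

lemma mul_single_eq (b : Matrix (Fin m) (Fin m) K) (i j : Fin m) :
    b * Matrix.single i j 1 = ∑ k, b k i • Matrix.single k j (1 : K) := by
  ext x y
  rw [Matrix.sum_apply]
  by_cases h : j = y <;>
    simp [Matrix.mul_apply, Matrix.single_apply, h]

lemma single_mul_eq (b : Matrix (Fin m) (Fin m) K) (i j : Fin m) :
    Matrix.single i j 1 * b = ∑ k, b j k • Matrix.single i k (1 : K) := by
  ext x y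
  rw [Matrix.sum_apply]
  by_cases h : i = x <;>
    simp [Matrix.mul_apply, Matrix.single_apply, h]

/-- The Casimir tensor `Σ Eᵢⱼ ⊗ Eⱼᵢ` is invariant. -/
lemma casimir_invariant {W : Type*} [AddCommGroup W] [Module K W]
    (β : Matrix (Fin m) (Fin m) K →ₗ[K] Matrix (Fin m) (Fin m) K →ₗ[K] W)
    (b : Matrix (Fin m) (Fin m) K) :
    ∑ i, ∑ j, (β (b * Matrix.single i j 1 - Matrix.single i j 1 * b) (Matrix.single j i 1)
      + β (Matrix.single i j 1) (b * Matrix.single j i 1 - Matrix.single j i 1 * b)) = 0 := by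
  have h1 : ∑ i, ∑ j, β (b * Matrix.single i j 1) (Matrix.single j i 1)
      = ∑ i, ∑ j, β (Matrix.single i j 1) (Matrix.single j i 1 * b) := by
    simp only [mul_single_eq, single_mul_eq, map_sum, map_smul, LinearMap.sum_apply,
      LinearMap.smul_apply]
    rw [Finset.sum_comm]
    conv_rhs => rw [Finset.sum_comm]
    refine Finset.sum_congr rfl fun j _ => ?_
    rw [Finset.sum_comm]
  have h2 : ∑ i, ∑ j, β (Matrix.single i j 1 * b) (Matrix.single j i 1)
      = ∑ i, ∑ j, β (Matrix.single i j 1) (b * Matrix.single j i 1) := by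
    simp only [mul_single_eq, single_mul_eq, map_sum, map_smul, LinearMap.sum_apply,
      LinearMap.smul_apply]
    refine Finset.sum_congr rfl fun i _ => ?_
    rw [Finset.sum_comm]
  simp only [map_sub, LinearMap.sub_apply, Finset.sum_add_distrib, Finset.sum_sub_distrib, h1, h2]
  abel

lemma casimir_apply (X : Matrix (Fin m) (Fin m) K) :
    ∑ i, ∑ j, (Matrix.single i j 1 * (Matrix.single j i 1 * X - X * Matrix.single j i 1)
      - (Matrix.single j i 1 * X - X * Matrix.single j i 1) * Matrix.single i j 1)
      = (2 * m : K) • X - (2 * X.trace) • (1 : Matrix (Fin m) (Fin m) K) := by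
  have h1 : ∑ i : Fin m, Matrix.single i i (1 : K) = 1 := Matrix.sum_single_one
  have h2 : ∀ i j : Fin m, (Matrix.single i j 1 * (X * Matrix.single j i 1))
      = X j j • Matrix.single i i (1 : K) := by
    intro i j
    rw [← Matrix.mul_assoc, Matrix.single_mul_mul_single]
    simp
  have h3 : ∀ i j : Fin m, Matrix.single i j (1 : K) * Matrix.single j i 1
      = Matrix.single i i 1 := by intro i j; simp
  have h4 : ∀ i j : Fin m, Matrix.single i j 1 * (Matrix.single j i 1 * X - X * Matrix.single j i 1)
      - (Matrix.single j i 1 * X - X * Matrix.single j i 1) * Matrix.single i j 1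
      = Matrix.single i i 1 * X - X j j • Matrix.single i i (1 : K)
        - X i i • Matrix.single j j (1 : K) + X * Matrix.single j j (1 : K) := by
    intro i j
    rw [mul_sub, sub_mul, h2, ← mul_assoc, h3, mul_assoc _ X, h2, mul_assoc, h3]
    abel
  simp only [h4, Finset.sum_add_distrib, Finset.sum_sub_distrib, ← Finset.sum_smul,
    ← Finset.smul_sum, ← Finset.mul_sum, h1, Finset.sum_const, Finset.card_univ,
    Fintype.card_fin, ← Finset.sum_mul]
  have h5 : ∑ i, X i i = X.trace := rfl
  rw [h5]
  simp only [one_mul, mul_smul_comm, mul_one, ← Nat.cast_smul_eq_nsmul K]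
  module

/-- A `1`-cocycle of `gl_m` in its adjoint module is inner up to scalar matrices. -/
lemma adjoint_cocycle (G : Matrix (Fin m) (Fin m) K →ₗ[K] Matrix (Fin m) (Fin m) K)
    (b X : Matrix (Fin m) (Fin m) K)
    (h : ∀ c, G (b * c - c * b) = b * G c - G c * b - (c * X - X * c)) :
    b * (∑ i, ∑ j, (Matrix.single i j 1 * G (Matrix.single j i 1)
        - G (Matrix.single j i 1) * Matrix.single i j 1))
      - (∑ i, ∑ j, (Matrix.single i j 1 * G (Matrix.single j i 1)
        - G (Matrix.single j i 1) * Matrix.single i j 1)) * b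
      = (2 * m : K) • X - (2 * X.trace) • (1 : Matrix (Fin m) (Fin m) K) := by
  let β : Matrix (Fin m) (Fin m) K →ₗ[K] Matrix (Fin m) (Fin m) K →ₗ[K]
      Matrix (Fin m) (Fin m) K :=
    LinearMap.mk₂ K (fun P Q => P * G Q - G Q * P)
      (fun P P' Q => by rw [add_mul, mul_add]; abel)
      (fun c P Q => by rw [smul_mul_assoc, mul_smul_comm, smul_sub])
      (fun P Q Q' => by rw [map_add, add_mul, mul_add]; abel)
      (fun c P Q => by rw [map_smul, smul_mul_assoc, mul_smul_comm, smul_sub])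
  have h1 := casimir_invariant β b
  rw [← casimir_apply, Finset.mul_sum, Finset.sum_mul, ← Finset.sum_sub_distrib,
    ← sub_zero (∑ i, _), ← h1, ← Finset.sum_sub_distrib]
  refine Finset.sum_congr rfl fun i _ => ?_
  rw [Finset.mul_sum, Finset.sum_mul, ← Finset.sum_sub_distrib, ← Finset.sum_sub_distrib]
  refine Finset.sum_congr rfl fun j _ => ?_
  simp only [β, LinearMap.mk₂_apply, h]
  noncomm_ring

end Casimir

section Homotopy

variable {m : ℕ} {K}

/-- The `2`-cocycles of parity `p` of `gl(m|1)` with coefficients in `V`. -/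
structure IsTwoCocycle (p : ZMod 2) (f : gl K m 1 →ₗ[K] gl K m 1 →ₗ[K] Wam K m) : Prop where
  mem : ∀ (pA pB : ZMod 2) (A B : gl K m 1), IsHom K pA A → IsHom K pB B →
    f A B ∈ Vpart K m (pA + pB + p)
  skew : ∀ (pA pB : ZMod 2) (A B : gl K m 1), IsHom K pA A → IsHom K pB B →
    f B A = -(sg K (pA * pB) • f A B)
  cocycle : ∀ (pA pB pC : ZMod 2) (A B C : gl K m 1),
    IsHom K pA A → IsHom K pB B → IsHom K pC C →
    sg K (p * pA) • rho K A (f B C)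
      - sg K (pA * pB + p * pB) • rho K B (f A C)
      + sg K ((pA + pB) * pC + p * pC) • rho K C (f A B)
      - f (sbr K A B) C + sg K (pB * pC) • f (sbr K A C) B + f A (sbr K B C) = 0

/-- The coboundary of a `1`-cochain `φ` of parity `p`, on elements of parities `pA` and `pB`. -/
def cobd (p pA pB : ZMod 2) (φ : gl K m 1 →ₗ[K] Wam K m) (A B : gl K m 1) : Wam K m :=
  sg K (p * pA) • rho K A (φ B) - sg K (pA * pB + p * pB) • rho K B (φ A) - φ (sbr K A B)

lemma cobd_add (p pA pB : ZMod 2) (φ ψ : gl K m 1 →ₗ[K] Wam K m) (A B : gl K m 1) :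
    cobd p pA pB (φ + ψ) A B = cobd p pA pB φ A B + cobd p pA pB ψ A B := by
  simp only [cobd, LinearMap.add_apply, map_add, smul_add]
  abel

lemma cobd_add_left (p pA pB : ZMod 2) (φ : gl K m 1 →ₗ[K] Wam K m) (A A' B : gl K m 1) :
    cobd p pA pB φ (A + A') B = cobd p pA pB φ A B + cobd p pA pB φ A' B := by
  simp only [cobd, LinearMap.add_apply, map_add, smul_add, rho_add, sbr_add_left]
  abel

lemma cobd_add_right (p pA pB : ZMod 2) (φ : gl K m 1 →ₗ[K] Wam K m) (A B B' : gl K m 1) :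
    cobd p pA pB φ A (B + B') = cobd p pA pB φ A B + cobd p pA pB φ A B' := by
  simp only [cobd, LinearMap.add_apply, map_add, smul_add, rho_add, sbr_add_right]
  abel

lemma sbr_swap {pA pB : ZMod 2} {A B : gl K m 1} (hA : IsHom K pA A) (hB : IsHom K pB B) :
    sbr K B A = -(sg K (pA * pB) • sbr K A B) := by
  rw [sbr_eq hA hB, sbr_eq hB hA, mul_comm pB pA, smul_sub, smul_smul, sg_mul_self, one_smul,
    neg_sub]

lemma cobd_swap {p pA pB : ZMod 2} (φ : gl K m 1 →ₗ[K] Wam K m) {A B : gl K m 1}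
    (hA : IsHom K pA A) (hB : IsHom K pB B) :
    cobd p pB pA φ B A = -(sg K (pA * pB) • cobd p pA pB φ A B) := by
  have h : sg K (pA * pB) * sg K (pA * pB + p * pB) = sg K (p * pB) := by
    rw [sg_add, ← mul_assoc, sg_mul_self, one_mul]
  rw [cobd, cobd, sbr_swap hA hB, smul_sub, smul_sub, smul_smul, smul_smul, h, map_neg, map_smul,
    ← sg_add, mul_comm pB pA]
  abel

lemma Vpart_le_Vsub {q : ZMod 2} {v : Wam K m} (h : v ∈ Vpart K m q) (r : Fin m) :
    v r ∈ ⋀[K]^(m - 1 - (r : ℕ)) (Fin m → K) := by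
  have h1 := h r trivial
  dsimp only at h1
  split_ifs at h1
  · exact h1
  · rw [(Submodule.mem_bot K).1 h1]
    exact Submodule.zero_mem _

lemma IsHom.eq_zero_or {q : ZMod 2} {w : ℤ} {A : gl K m 1} (h : IsHom K q A) (hw : HasWt K w A) :
    A = 0 ∨ q = (w : ZMod 2) := by
  by_contra! hne
  refine hne.1 (Matrix.ext fun i j => by_contra fun hij => hne.2 ?_)
  rw [← h i j hij, hw.isHom i j hij]

/-- The contracting homotopy on the nonzero weight spaces of the grading element. -/
noncomputable def homotopy (f : gl K m 1 →ₗ[K] gl K m 1 →ₗ[K] Wam K m) :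
    gl K m 1 →ₗ[K] Wam K m :=
  LinearMap.pi fun r => LinearMap.proj r ∘ₗ f (gradeElt K m) ∘ₗ
    ((((-1 - (r : ℕ) - (-1) : ℤ) : K)⁻¹) • wtProj K (-1)
      + (((-1 - (r : ℕ) - 0 : ℤ) : K)⁻¹) • wtProj K 0
      + (((-1 - (r : ℕ) - 1 : ℤ) : K)⁻¹) • wtProj K 1)

lemma homotopy_apply (f : gl K m 1 →ₗ[K] gl K m 1 →ₗ[K] Wam K m) {w : ℤ} {A : gl K m 1}
    (h : HasWt K w A) (r : Fin m) :
    homotopy f A r = ((-1 - (r : ℕ) - w : ℤ) : K)⁻¹ • f (gradeElt K m) A r := by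
  simp only [homotopy, LinearMap.pi_apply, LinearMap.comp_apply, LinearMap.add_apply,
    LinearMap.smul_apply, wtProj_of_hasWt h, LinearMap.proj_apply]
  by_cases h1 : w = -1
  · subst h1; simp
  by_cases h2 : w = 0
  · subst h2; simp
  by_cases h3 : w = 1
  · subst h3; simp
  rw [h.eq_zero h1 h2 h3]
  simp

lemma homotopy_mem {p q : ZMod 2} {f : gl K m 1 →ₗ[K] gl K m 1 →ₗ[K] Wam K m}
    (hf : IsTwoCocycle p f) {A : gl K m 1} (hA : IsHom K q A) :
    homotopy f A ∈ Vpart K m (q + p) := by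
  intro r _
  have h : ∀ w, f (gradeElt K m) (wtProj K w A) r ∈ _ := fun w => by
    have := hf.mem 0 q _ _ hasWt_gradeElt.isHom_zero (hA.wtProj w)
    rw [zero_add] at this
    exact this r trivial
  simp only [homotopy, LinearMap.pi_apply, LinearMap.comp_apply, LinearMap.add_apply,
    LinearMap.smul_apply, LinearMap.proj_apply, map_add, map_smul]
  exact Submodule.add_mem _ (Submodule.add_mem _ (Submodule.smul_mem _ _ (h _))
    (Submodule.smul_mem _ _ (h _))) (Submodule.smul_mem _ _ (h _))

lemma cobd_homotopy {p : ZMod 2} {f : gl K m 1 →ₗ[K] gl K m 1 →ₗ[K] Wam K m}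
    (hf : IsTwoCocycle p f) {i j : ℤ} {A B : gl K m 1} (hA : HasWt K i A) (hB : HasWt K j B)
    (r : Fin m) :
    cobd p i j (homotopy f) A B r = ((-1 - (r : ℕ) - i - j : ℤ) : K)⁻¹ •
      (((-1 - (r : ℕ) - i - j : ℤ) : K) • f A B r) := by
  have h1 : rho K A (homotopy f B) r = ((-1 - (r : ℕ) - i - j : ℤ) : K)⁻¹ •
      rho K A (f (gradeElt K m) B) r :=
    hA.rho_congr _ fun s hs => by
      rw [homotopy_apply f hB, show (-1 - (s : ℕ) - j : ℤ) = -1 - (r : ℕ) - i - j by omega]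
  have h2 : rho K B (homotopy f A) r = ((-1 - (r : ℕ) - i - j : ℤ) : K)⁻¹ •
      rho K B (f (gradeElt K m) A) r :=
    hB.rho_congr _ fun s hs => by
      rw [homotopy_apply f hA, show (-1 - (s : ℕ) - i : ℤ) = -1 - (r : ℕ) - i - j by omega]
  have h3 := homotopy_apply f (hA.sbr hB) r
  rw [show (-1 - (r : ℕ) - (i + j) : ℤ) = -1 - (r : ℕ) - i - j by omega] at h3
  have h4 := congrFun (hf.cocycle 0 i j _ _ _ hasWt_gradeElt.isHom_zero hA.isHom hB.isHom) r
  rw [sbr_gradeElt hA, sbr_gradeElt hB] at h4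
  simp only [Pi.add_apply, Pi.sub_apply, Pi.smul_apply, map_smul, LinearMap.smul_apply,
    rho_gradeElt (Vpart_le_Vsub (hf.mem _ _ _ _ hA.isHom hB.isHom) r), mul_zero, zero_mul, zero_add,
    sg_zero, one_smul, Pi.zero_apply, hf.skew _ _ _ _ hA.isHom hB.isHom, Pi.neg_apply] at h4
  rw [smul_neg, smul_neg, smul_comm (sg K _) ((j : ℤ) : K), smul_smul (sg K _), sg_mul_self,
    one_smul] at h4
  simp only [cobd, Pi.sub_apply, Pi.smul_apply, h1, h2, h3]
  rw [smul_comm (sg K _), smul_comm (sg K _), ← smul_sub, ← smul_sub]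
  congr 1
  rw [← sub_eq_zero, ← neg_eq_zero, ← h4]
  push_cast
  module

end Homotopy

section Blocks

variable {m : ℕ} {K}

/-- The matrix with prescribed blocks. -/
def block (a : Matrix (Fin m) (Fin m) K) (x y : Fin m → K) (d : K) : gl K m 1 :=
  Matrix.of (Fin.snoc (α := fun _ => Fin (m + 1) → K)
    (fun i => Fin.snoc (α := fun _ => K) (a i) (x i)) (Fin.snoc (α := fun _ => K) y d))

@[simp] lemma blka_block (a : Matrix (Fin m) (Fin m) K) (x y : Fin m → K) (d : K) :
    blka K (block a x y d) = a := by
  ext i j; simp [blka, block]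

@[simp] lemma blkx_block (a : Matrix (Fin m) (Fin m) K) (x y : Fin m → K) (d : K) :
    blkx K (block a x y d) = x := by
  ext i; simp [blkx, block]

@[simp] lemma rowy_block (a : Matrix (Fin m) (Fin m) K) (x y : Fin m → K) (d : K) :
    rowy K (block a x y d) = y := by
  ext i; simp [rowy, block]

@[simp] lemma blkd_block (a : Matrix (Fin m) (Fin m) K) (x y : Fin m → K) (d : K) :
    blkd K (block a x y d) = d := by
  simp [blkd, block]

lemma ext_blocks {A B : gl K m 1} (ha : blka K A = blka K B) (hx : blkx K A = blkx K B)
    (hy : rowy K A = rowy K B) (hd : blkd K A = blkd K B) : A = B := by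
  ext i j
  refine Fin.lastCases ?_ (fun i => ?_) i <;> refine Fin.lastCases ?_ (fun j => ?_) j
  · exact hd
  · exact congrFun hy j
  · exact congrFun hx i
  · exact congrFun (congrFun ha i) j

lemma HasWt.ext_zero {A B : gl K m 1} (hA : HasWt K 0 A) (hB : HasWt K 0 B)
    (ha : blka K A = blka K B) (hd : blkd K A = blkd K B) : A = B :=
  ext_blocks ha (by rw [hA.blkx_eq_zero (by decide), hB.blkx_eq_zero (by decide)])
    (by rw [hA.rowy_eq_zero (by decide), hB.rowy_eq_zero (by decide)]) hd

lemma HasWt.ext_neg_one {A B : gl K m 1} (hA : HasWt K (-1) A) (hB : HasWt K (-1) B)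
    (h : rowy K A = rowy K B) : A = B :=
  ext_blocks (by rw [hA.blka_eq_zero (by decide), hB.blka_eq_zero (by decide)])
    (by rw [hA.blkx_eq_zero (by decide), hB.blkx_eq_zero (by decide)]) h
    (by rw [hA.blkd_eq_zero (by decide), hB.blkd_eq_zero (by decide)])

lemma hasWt_block_zero (a : Matrix (Fin m) (Fin m) K) (d : K) : HasWt K 0 (block a 0 0 d) := by
  intro i j
  refine Fin.lastCases ?_ (fun i => ?_) i <;> refine Fin.lastCases ?_ (fun j => ?_) j <;>
    simp [block, eps_last, eps_castSucc]

lemma hasWt_block_one (x : Fin m → K) : HasWt K 1 (block 0 x 0 0) := by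
  intro i j
  refine Fin.lastCases ?_ (fun i => ?_) i <;> refine Fin.lastCases ?_ (fun j => ?_) j <;>
    simp [block, eps_last, eps_castSucc]

lemma hasWt_block_neg_one (y : Fin m → K) : HasWt K (-1) (block 0 0 y 0) := by
  intro i j
  refine Fin.lastCases ?_ (fun i => ?_) i <;> refine Fin.lastCases ?_ (fun j => ?_) j <;>
    simp [block, eps_last, eps_castSucc]

variable (K m) in
/-- The embedding of `gl_m` as the upper-left block. -/
def blockHom : Matrix (Fin m) (Fin m) K →ₗ[K] gl K m 1 where
  toFun a := block a 0 0 0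
  map_add' a b := ext_blocks (by simp [blka_add]) (by simp [blkx_add]) (by simp [rowy_add])
    (by simp [blkd_add])
  map_smul' c a := ext_blocks (by simp [blka_smul]) (by simp [blkx_smul]) (by simp [rowy_smul])
    (by simp [blkd_smul])

lemma blockHom_apply (a : Matrix (Fin m) (Fin m) K) : blockHom K m a = block a 0 0 0 := rfl

lemma blkd_sbr {A B : gl K m 1} (hA : HasWt K 0 A) (hB : HasWt K 0 B) :
    blkd K (sbr K A B) = 0 := by
  have hA' : ∀ j, A (Fin.last m) (Fin.castSucc j) = 0 := congrFun (hA.rowy_eq_zero (by decide))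
  have hB' : ∀ j, B (Fin.last m) (Fin.castSucc j) = 0 := congrFun (hB.rowy_eq_zero (by decide))
  rw [sbr_of_hasWt_zero hA hB.isHom]
  simp only [blkd, Matrix.sub_apply, Matrix.mul_apply]
  rw [Fin.sum_univ_castSucc, Fin.sum_univ_castSucc]
  simp [hA', hB', mul_comm]

lemma eq_sum_of_hasWt_neg_one {C : gl K m 1} (hC : HasWt K (-1) C) :
    C = ∑ k, rowy K C k • block 0 0 (Pi.single k 1) 0 := by
  have h1 : HasWt K (-1) (∑ k, rowy K C k • block (m := m) (K := K) 0 0 (Pi.single k 1) 0) :=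
    Finset.sum_induction _ _ (fun _ _ => HasWt.add) (fun i j h => absurd rfl h)
      fun k _ => (hasWt_block_neg_one _).smul _
  refine hC.ext_neg_one h1 ?_
  let L : gl K m 1 →ₗ[K] Fin m → K :=
    { toFun := rowy K, map_add' := rowy_add K, map_smul' := rowy_smul K }
  have hL : ∀ A, rowy K A = L A := fun _ => rfl
  rw [hL (∑ k, _), map_sum]
  simp only [← hL, rowy_smul, rowy_block]
  ext l
  simp [Finset.sum_apply, Pi.single_apply]

lemma covTop_injective : Function.Injective (covTop K m) := fun u v h => by
  ext l
  rw [← topCoeff_wmul_covTop K l u, h, topCoeff_wmul_covTop]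

end Blocks

section LowerWeights

variable {m : ℕ} {K} {p : ZMod 2} {f : gl K m 1 →ₗ[K] gl K m 1 →ₗ[K] Wam K m}

/-- The matrix of the slot-`0` part of `f(A, -)` on the lower-left block. -/
noncomputable def lowMatrix (f : gl K m 1 →ₗ[K] gl K m 1 →ₗ[K] Wam K m) (hm : 0 < m) :
    gl K m 1 →ₗ[K] Matrix (Fin m) (Fin m) K where
  toFun A := Matrix.of fun k l => topCoeff K m (wmul K (Pi.single l 1)
    (f A (block 0 0 (Pi.single k 1) 0) ⟨0, hm⟩))
  map_add' A B := by ext k l; simp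
  map_smul' c A := by ext k l; simp

lemma IsTwoCocycle.eq_covTop_lowMatrix (hf : IsTwoCocycle p f) (hm : 0 < m) {A C : gl K m 1}
    (hA : HasWt K 0 A) (hC : HasWt K (-1) C) :
    f A C ⟨0, hm⟩ = covTop K m (rowy K C ᵥ* lowMatrix f hm A) := by
  have h : ∀ k, f A (block 0 0 (Pi.single k 1) 0) ⟨0, hm⟩ = covTop K m (lowMatrix f hm A k) :=
    fun k => eq_covTop K hm (Vpart_le_Vsub
      (hf.mem _ _ _ _ hA.isHom (hasWt_block_neg_one _).isHom) ⟨0, hm⟩)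
  conv_lhs => rw [eq_sum_of_hasWt_neg_one hC]
  simp only [map_sum, map_smul, Finset.sum_apply, Pi.smul_apply, h]
  simp only [← map_smul, ← map_sum]
  congr 1
  ext l
  simp [Matrix.vecMul, dotProduct]

lemma IsTwoCocycle.lowMatrix_sbr (hf : IsTwoCocycle p f) (hm : 0 < m) {A B : gl K m 1}
    (hA : HasWt K 0 A) (hB : HasWt K 0 B) :
    lowMatrix f hm (sbr K A B) = (blka K A * lowMatrix f hm B - lowMatrix f hm B * blka K A)
      - (blka K B * lowMatrix f hm A - lowMatrix f hm A * blka K B) := by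
  have key : ∀ y : Fin m → K, y ᵥ* lowMatrix f hm (sbr K A B)
      = y ᵥ* ((blka K A * lowMatrix f hm B - lowMatrix f hm B * blka K A)
      - (blka K B * lowMatrix f hm A - lowMatrix f hm A * blka K B)) := by
    intro y
    have hC := hasWt_block_neg_one (K := K) y
    have hAB : HasWt K 0 (sbr K A B) := by simpa using hA.sbr hB
    have hAC : HasWt K (-1) (sbr K A (block 0 0 y 0)) := by simpa using hA.sbr hC
    have hBC : HasWt K (-1) (sbr K B (block 0 0 y 0)) := by simpa using hB.sbr hC
    have h1 := congrFun (hf.cocycle 0 0 1 _ _ _ hA.isHom_zero hB.isHom_zero hC.isHom_neg_one)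
      ⟨0, hm⟩
    rw [hf.skew 0 1 _ _ hB.isHom_zero hAC.isHom_neg_one] at h1
    simp only [Pi.add_apply, Pi.sub_apply, Pi.smul_apply, Pi.neg_apply, mul_zero, zero_mul,
      add_zero, sg_zero, one_smul, Pi.zero_apply,
      rho_covTop hm hA (hf.eq_covTop_lowMatrix hm hB hC),
      rho_covTop hm hB (hf.eq_covTop_lowMatrix hm hA hC),
      hf.eq_covTop_lowMatrix hm hAB hC, hf.eq_covTop_lowMatrix hm hA hBC,
      hf.eq_covTop_lowMatrix hm hB hAC, rowy_sbr hA hC.isHom, rowy_sbr hB hC.isHom,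
      rowy_block] at h1
    rw [hC.rho_eq_zero fun s hs => absurd hs (by simp), smul_zero, add_zero,
      ← map_neg, ← map_sub, ← map_sub, ← map_add, ← map_add] at h1
    have h2 := covTop_injective (h1.trans (map_zero _).symm)
    rw [← sub_eq_zero, ← neg_eq_zero, ← h2]
    simp only [Matrix.vecMul_sub, Matrix.sub_vecMul, Matrix.smul_vecMul, Matrix.vecMul_vecMul]
    abel
  ext i j
  simpa using congrFun (key (Pi.single i 1)) j

/-- The slot-`0` part of a cocycle on the blocks of weights `0` and `-1`. -/
lemma IsTwoCocycle.exists_primitive [CharZero K] (hf : IsTwoCocycle p f) (hm : 0 < m) :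
    ∃ (N : Matrix (Fin m) (Fin m) K) (l : gl K m 1 →ₗ[K] K),
      (((m - 1 : ℕ) : ZMod 2) ≠ 1 + p → N = 0) ∧
      ∀ A C, HasWt K 0 A → HasWt K (-1) C → f A C ⟨0, hm⟩
        = covTop K m (rowy K C ᵥ* (blka K A * N - N * blka K A)) + l A • covTop K m (rowy K C) := by
  by_cases hp : ((m - 1 : ℕ) : ZMod 2) = 1 + p
  swap
  · refine ⟨0, 0, fun _ => rfl, fun A C hA hC => ?_⟩
    have h := hf.mem 0 1 _ _ hA.isHom_zero hC.isHom_neg_one ⟨0, hm⟩ trivial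
    rw [zero_add] at h
    dsimp only at h
    rw [Nat.sub_zero, if_neg hp] at h
    simp [(Submodule.mem_bot K).1 h]
  have hm' : (m : K) ≠ 0 := by exact_mod_cast hm.ne'
  set F := lowMatrix f hm with hF
  set G := F ∘ₗ blockHom K m with hG
  refine ⟨(2 * m : K)⁻¹ • ∑ i, ∑ j, (Matrix.single i j 1 * G (Matrix.single j i 1)
        - G (Matrix.single j i 1) * Matrix.single i j 1),
    (m : K)⁻¹ • Matrix.traceLinearMap (Fin m) K K ∘ₗ F, fun h => absurd hp h, fun A C hA hC => ?_⟩
  have h1 := adjoint_cocycle G (blka K A) (F A) fun c => by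
    have hc := hasWt_block_zero c (0 : K)
    have h2 : blockHom K m (blka K A * c - c * blka K A) = sbr K A (block c 0 0 0) :=
      (hasWt_block_zero _ _).ext_zero (by simpa using hA.sbr hc)
        (by rw [blka_sbr hA hc, blka_block, blka_block]) (by rw [blkd_sbr hA hc, blkd_block])
    have h3 := hf.lowMatrix_sbr hm hA hc
    rw [← h2, blka_block] at h3
    exact h3
  rw [hf.eq_covTop_lowMatrix hm hA hC, Matrix.mul_smul, Matrix.smul_mul, ← smul_sub, h1, ← hF,
    ← map_smul (covTop K m), ← map_add (covTop K m)]
  congr 1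
  rw [smul_sub, smul_smul, smul_smul, inv_mul_cancel₀ (by simp [hm']), one_smul, Matrix.vecMul_sub,
    Matrix.vecMul_smul, Matrix.vecMul_one]
  simp only [LinearMap.smul_apply, LinearMap.comp_apply, Matrix.traceLinearMap_apply, smul_eq_mul]
  rw [show (2 * (m : K))⁻¹ * (2 * (F A).trace) = (m : K)⁻¹ * (F A).trace by field_simp,
    sub_add_cancel]

end LowerWeights

section Assembly

variable {m : ℕ} {K} {p : ZMod 2} {f : gl K m 1 →ₗ[K] gl K m 1 →ₗ[K] Wam K m}

lemma blky_apply (C : gl K m 1) (x : Fin m → K) : blky K C x = rowy K C ⬝ᵥ x := by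
  simp [blky, rowy, dotProduct]

lemma wmul_ctr_covTop (C : gl K m 1) (x u : Fin m → K) :
    wmul K x (ctr K (blky K C) (covTop K m u))
      = covTop K m ((rowy K C ⬝ᵥ x) • u - (u ⬝ᵥ x) • rowy K C) := by
  rw [wmul_ctr, blky_apply, wmul_covTop, map_smul, ctr_blky_topWedge, map_sub, map_smul, map_smul]

/-- The defect of the slot-`1` part of a cocycle on the lower-left block. -/
lemma IsTwoCocycle.wmul_defect (hf : IsTwoCocycle p f) (hm : 1 < m)
    {N : Matrix (Fin m) (Fin m) K} {l : gl K m 1 →ₗ[K] K}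
    (hN : ∀ A C, HasWt K 0 A → HasWt K (-1) C → f A C ⟨0, by omega⟩
        = covTop K m (rowy K C ᵥ* (blka K A * N - N * blka K A)) + l A • covTop K m (rowy K C))
    {X B C : gl K m 1} (hX : HasWt K 1 X) (hB : HasWt K (-1) B) (hC : HasWt K (-1) C) :
    wmul K (blkx K X) (sg K p • f B C ⟨1, hm⟩ - ctr K (blky K B) (covTop K m (rowy K C ᵥ* N))
        - ctr K (blky K C) (covTop K m (rowy K B ᵥ* N)))
      = covTop K m (l (sbr K X B) • rowy K C + l (sbr K X C) • rowy K B) := by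
  have hXB : HasWt K 0 (sbr K X B) := by simpa using hX.sbr hB
  have hXC : HasWt K 0 (sbr K X C) := by simpa using hX.sbr hC
  have hBC : sbr K B C = 0 := (hB.sbr hC).eq_zero (by decide) (by decide) (by decide)
  have h1 := congrFun (hf.cocycle 1 1 1 _ _ _ hX.isHom_one hB.isHom_neg_one hC.isHom_neg_one)
    ⟨0, by omega⟩
  have h2 : rho K X (f B C) ⟨0, by omega⟩ = wmul K (blkx K X) (f B C ⟨1, hm⟩) := by
    rw [rho_apply, hX.blka_eq_zero (by decide), hX.blkd_eq_zero (by decide), theta_zero]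
    simp [hm]
  simp only [Pi.add_apply, Pi.sub_apply, Pi.smul_apply, hBC, map_zero, Pi.zero_apply, h2,
    hN _ _ hXB hC, hN _ _ hXC hB, blka_sbr_one_neg_one hX hB, blka_sbr_one_neg_one hX hC,
    mul_one, sg_one] at h1
  rw [hB.rho_eq_zero fun s hs => absurd hs (by simp),
    hC.rho_eq_zero fun s hs => absurd hs (by simp)] at h1
  simp only [smul_zero, sub_zero, add_zero, neg_one_smul] at h1
  have h3 : ∀ (y z : Fin m → K),
      z ᵥ* (Matrix.vecMulVec (blkx K X) y * N - N * Matrix.vecMulVec (blkx K X) y)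
      = (z ⬝ᵥ blkx K X) • (y ᵥ* N) - ((z ᵥ* N) ⬝ᵥ blkx K X) • y := by
    intro y z
    rw [Matrix.vecMul_sub, ← Matrix.vecMul_vecMul, ← Matrix.vecMul_vecMul, Matrix.vecMul_vecMulVec,
      Matrix.vecMul_vecMulVec, Matrix.smul_vecMul]
  rw [h3, h3, ← sub_eq_add_neg, sub_sub, sub_eq_zero] at h1
  rw [map_sub, map_sub, map_smul, h1, wmul_ctr_covTop, wmul_ctr_covTop]
  simp only [map_add, map_sub, map_smul]
  abel

lemma IsTwoCocycle.map_sbr_eq_zero [CharZero K] (hf : IsTwoCocycle p f) (hm : 1 < m)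
    {N : Matrix (Fin m) (Fin m) K} {l : gl K m 1 →ₗ[K] K}
    (hN : ∀ A C, HasWt K 0 A → HasWt K (-1) C → f A C ⟨0, by omega⟩
        = covTop K m (rowy K C ᵥ* (blka K A * N - N * blka K A)) + l A • covTop K m (rowy K C))
    {X B : gl K m 1} (hX : HasWt K 1 X) (hB : HasWt K (-1) B) : l (sbr K X B) = 0 := by
  have key : ∀ {B C : gl K m 1}, HasWt K (-1) B → HasWt K (-1) C →
      l (sbr K X B) * (rowy K C ⬝ᵥ blkx K X) + l (sbr K X C) * (rowy K B ⬝ᵥ blkx K X) = 0 := by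
    intro B C hB hC
    have h1 := congrArg (wmul K (blkx K X)) (hf.wmul_defect hm hN hX hB hC)
    rw [wmul_wmul_self, wmul_covTop] at h1
    have h2 := congrArg (topCoeff K m) h1
    rw [map_zero, map_smul, topCoeff_topWedge] at h2
    simpa [add_dotProduct] using h2.symm
  by_cases hx : blkx K X = 0
  · have h0 : X = 0 := ext_blocks (by rw [hX.blka_eq_zero (by decide)]; rfl) hx
      (by rw [hX.rowy_eq_zero (by decide)]; rfl) (by rw [hX.blkd_eq_zero (by decide)]; rfl)
    have h1 : sbr K (0 : gl K m 1) B = 0 := by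
      have := sbr_add_left (0 : gl K m 1) 0 B
      simpa using this
    rw [h0, h1, map_zero]
  obtain ⟨i, hi⟩ := Function.ne_iff.1 hx
  have hY := hasWt_block_neg_one (K := K) (Pi.single i 1 : Fin m → K)
  have h1 := key hY hY
  rw [rowy_block, single_one_dotProduct, ← two_mul] at h1
  have h2 : l (sbr K X (block 0 0 (Pi.single i 1) 0)) = 0 := by
    simpa [show blkx K X i ≠ 0 from hi] using h1
  have h3 := key hB hY
  rw [rowy_block, single_one_dotProduct, h2, zero_mul, add_zero] at h3
  exact (mul_eq_zero.1 h3).resolve_right hi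

lemma eq_smul_str {l : gl K m 1 →ₗ[K] K}
    (h : ∀ X B : gl K m 1, HasWt K 1 X → HasWt K (-1) B → l (sbr K X B) = 0)
    {A : gl K m 1} (hA : HasWt K 0 A) : l A = -l (block 0 0 0 1) * str K A := by
  have h1 : l ∘ₗ blockHom K m = -l (block 0 0 0 1) • Matrix.traceLinearMap (Fin m) K K := by
    refine Matrix.ext_linearMap _ fun i j => LinearMap.ext_ring ?_
    have hX := hasWt_block_one (K := K) (Pi.single i 1 : Fin m → K)
    have hY := hasWt_block_neg_one (K := K) (Pi.single j 1 : Fin m → K)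
    have h2 : block (Matrix.single i j 1) 0 0 0
        = sbr K (block 0 (Pi.single i 1) 0 0) (block 0 0 (Pi.single j 1) 0)
          - (Matrix.single i j (1 : K)).trace • block 0 0 0 1 := by
      refine (hasWt_block_zero _ _).ext_zero
        (HasWt.sub (by simpa using hX.sbr hY) ((hasWt_block_zero _ _).smul _)) ?_ ?_
      · rw [sub_eq_add_neg, ← neg_smul, blka_add, blka_smul, blka_sbr_one_neg_one hX hY]
        simp [Matrix.single_eq_single_vecMulVec_single]
      · rw [sub_eq_add_neg, ← neg_smul, blkd_add, blkd_smul, blkd_sbr_one_neg_one hX hY]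
        by_cases hij : i = j
        · subst hij; simp
        · simp [hij, Matrix.trace_single_eq_of_ne]
    change l (block (Matrix.single i j 1) 0 0 0) = -l (block 0 0 0 1) • (Matrix.single i j 1).trace
    rw [h2, map_sub, map_smul, h _ _ hX hY, smul_eq_mul, smul_eq_mul]
    ring
  have h3 : A = blockHom K m (blka K A) + blkd K A • block 0 0 0 1 :=
    hA.ext_zero ((hasWt_block_zero _ _).add ((hasWt_block_zero _ _).smul _))
      (by simp [blka_add, blka_smul, blockHom_apply]) (by simp [blkd_add, blkd_smul, blockHom_apply])
  have h4 := LinearMap.congr_fun h1 (blka K A)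
  simp only [LinearMap.comp_apply, LinearMap.smul_apply, Matrix.traceLinearMap_apply,
    smul_eq_mul] at h4
  conv_lhs => rw [h3]
  rw [map_add, map_smul, h4, str_eq, smul_eq_mul]
  ring

lemma IsTwoCocycle.slot_one_eq [CharZero K] (hf : IsTwoCocycle p f) (hm : 1 < m)
    {N : Matrix (Fin m) (Fin m) K} {l : gl K m 1 →ₗ[K] K}
    (hN : ∀ A C, HasWt K 0 A → HasWt K (-1) C → f A C ⟨0, by omega⟩
        = covTop K m (rowy K C ᵥ* (blka K A * N - N * blka K A)) + l A • covTop K m (rowy K C))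
    {B C : gl K m 1} (hB : HasWt K (-1) B) (hC : HasWt K (-1) C) :
    f B C ⟨1, hm⟩ = sg K p • (ctr K (blky K B) (covTop K m (rowy K C ᵥ* N))
        + ctr K (blky K C) (covTop K m (rowy K B ᵥ* N))) := by
  have hmem : ∀ (D : gl K m 1) u, ctr K (blky K D) (covTop K m u)
      ∈ ⋀[K]^(m - 1 - 1) (Fin m → K) := fun D u => ctr_mem K _ (covTop_mem K u)
  have h1 := eq_zero_of_wmul_eq_zero K (k := m - 1 - 1) (by omega)
    (Submodule.sub_mem _ (Submodule.sub_mem _ (Submodule.smul_mem _ (sg K p)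
      (Vpart_le_Vsub (hf.mem _ _ _ _ hB.isHom hC.isHom) ⟨1, hm⟩)) (hmem B (rowy K C ᵥ* N)))
      (hmem C (rowy K B ᵥ* N))) fun i => by
        have hX := hasWt_block_one (K := K) (Pi.single i 1 : Fin m → K)
        have := hf.wmul_defect hm hN hX hB hC
        rwa [hf.map_sbr_eq_zero hm hN hX hB, hf.map_sbr_eq_zero hm hN hX hC, zero_smul, zero_smul,
          add_zero, map_zero, blkx_block] at this
  rw [sub_sub, sub_eq_zero] at h1
  rw [← h1, smul_smul, sg_mul_self, one_smul]

/-- The `1`-cochain with values in slot `0` attached to a matrix `N`. -/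
noncomputable def lowCochain (hm : 0 < m) (N : Matrix (Fin m) (Fin m) K) :
    gl K m 1 →ₗ[K] Wam K m where
  toFun A := Pi.single (⟨0, hm⟩ : Fin m) (covTop K m (rowy K A ᵥ* N))
  map_add' A B := by rw [rowy_add, Matrix.add_vecMul, map_add, Pi.single_add]
  map_smul' c A := by rw [rowy_smul, Matrix.smul_vecMul, map_smul, Pi.single_smul]; rfl

lemma lowCochain_zero (hm : 0 < m) (N : Matrix (Fin m) (Fin m) K) (A : gl K m 1) :
    lowCochain hm N A ⟨0, hm⟩ = covTop K m (rowy K A ᵥ* N) := by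
  simp [lowCochain]

lemma lowCochain_apply_eq_zero (hm : 0 < m) (N : Matrix (Fin m) (Fin m) K) {w : ℤ} {A : gl K m 1}
    (hA : HasWt K w A) {r : Fin m} (h : (r : ℤ) + w ≠ -1) : lowCochain hm N A r = 0 := by
  by_cases hr : r = ⟨0, hm⟩
  · subst hr
    rw [lowCochain_zero, hA.rowy_eq_zero (by simpa using h), Matrix.zero_vecMul, map_zero]
  · exact Pi.single_eq_of_ne hr _

lemma lowCochain_mem (hm : 0 < m) {N : Matrix (Fin m) (Fin m) K}
    (hN : ((m - 1 : ℕ) : ZMod 2) ≠ 1 + p → N = 0) {q : ZMod 2} {A : gl K m 1}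
    (hA : IsHom K q A) : lowCochain hm N A ∈ Vpart K m (q + p) := by
  intro r _
  by_cases hr : r = ⟨0, hm⟩
  · subst hr
    rw [lowCochain_zero]
    by_cases hp : ((m - 1 : ℕ) : ZMod 2) = 1 + p
    · rcases zmod_two_cases q with rfl | rfl
      · rw [hA.hasWt_zero.rowy_eq_zero (by decide), Matrix.zero_vecMul, map_zero]
        exact Submodule.zero_mem _
      · dsimp only
        rw [Nat.sub_zero, if_pos hp]
        exact covTop_mem K _
    · rw [hN hp, Matrix.vecMul_zero, map_zero]
      exact Submodule.zero_mem _
  · rw [lowCochain, LinearMap.coe_mk, AddHom.coe_mk, Pi.single_eq_of_ne hr]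
    exact Submodule.zero_mem _

end Assembly

section Classification

variable {m : ℕ} {K} {p : ZMod 2} {f : gl K m 1 →ₗ[K] gl K m 1 →ₗ[K] Wam K m}

lemma topAct_apply_eq_zero (hm : 0 < m) {w : ℤ} {A : gl K m 1} (hA : HasWt K w A) {r : Fin m}
    (h : (r : ℤ) + w ≠ -1) : topAct K hm A r = 0 := by
  by_cases hr : r = ⟨0, hm⟩
  · subst hr
    rw [topAct_of_rowy_eq_zero hm (hA.rowy_eq_zero (by simpa using h))]
    rfl
  · exact Pi.single_eq_of_ne hr _

lemma gV_apply_eq_zero (hm : 0 < m) {i j : ℤ} {A B : gl K m 1} (hA : HasWt K i A)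
    (hB : HasWt K j B) {r : Fin m} (h : (r : ℤ) + i + j ≠ -1) : gV K m hm A B r = 0 := by
  have key : ∀ {i j : ℤ} {A B : gl K m 1}, HasWt K i A → HasWt K j B → (r : ℤ) + i + j ≠ -1 →
      str K A • topAct K hm B r = 0 := by
    intro i j A B hA hB h
    by_cases hi : i = 0
    · rw [topAct_apply_eq_zero hm hB (by omega), smul_zero]
    · rw [hA.str_eq_zero hi, zero_smul]
  rw [gV_eq, Pi.sub_apply, Pi.smul_apply, Pi.smul_apply, key hA hB h, key hB hA (by omega),
    sub_zero]

lemma cobd_lowCochain_eq_zero (hm : 0 < m) (N : Matrix (Fin m) (Fin m) K) {i j : ℤ}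
    {pA pB : ZMod 2} {A B : gl K m 1} (hA : HasWt K i A) (hB : HasWt K j B) {r : Fin m}
    (h : (r : ℤ) + i + j ≠ -1) : cobd p pA pB (lowCochain hm N) A B r = 0 := by
  simp only [cobd, Pi.sub_apply, Pi.smul_apply]
  rw [hA.rho_eq_zero fun s hs => lowCochain_apply_eq_zero hm N hB (by omega),
    hB.rho_eq_zero fun s hs => lowCochain_apply_eq_zero hm N hA (by omega),
    lowCochain_apply_eq_zero hm N (hA.sbr hB) (by omega)]
  simp

lemma gV_swap (hm : 0 < m) (A B : gl K m 1) : gV K m hm B A = -gV K m hm A B := by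
  rw [gV_eq, gV_eq, neg_sub]

lemma gV_add_right (hm : 0 < m) (A B B' : gl K m 1) :
    gV K m hm A (B + B') = gV K m hm A B + gV K m hm A B' := by
  simp only [gV_eq, topAct_add, str_add]
  module

lemma gV_add_left (hm : 0 < m) (A A' B : gl K m 1) :
    gV K m hm (A + A') B = gV K m hm A B + gV K m hm A' B := by
  simp only [gV_eq, topAct_add, str_add]
  module

lemma gV_smul_right (hm : 0 < m) (c : K) (A B : gl K m 1) :
    gV K m hm A (c • B) = c • gV K m hm A B := by
  simp only [gV_eq, topAct_smul, str_smul]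
  module

lemma gV_smul_left (hm : 0 < m) (c : K) (A B : gl K m 1) :
    gV K m hm (c • A) B = c • gV K m hm A B := by
  simp only [gV_eq, topAct_smul, str_smul]
  module

/-- On weight vectors, a cocycle agrees in the invariant slots with a multiple of `g` plus the
coboundary of a cochain with values in slot `0`. -/
lemma IsTwoCocycle.eq_of_invariant [CharZero K] (hf : IsTwoCocycle p f) (hm : 1 < m)
    {N : Matrix (Fin m) (Fin m) K} {l : gl K m 1 →ₗ[K] K}
    (hN : ∀ A C, HasWt K 0 A → HasWt K (-1) C → f A C ⟨0, by omega⟩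
        = covTop K m (rowy K C ᵥ* (blka K A * N - N * blka K A)) + l A • covTop K m (rowy K C))
    {i j : ℤ} {A B : gl K m 1} (hA : HasWt K i A) (hB : HasWt K j B)
    (hi : -1 ≤ i) (hj : -1 ≤ j) {r : Fin m} (h : (r : ℤ) + i + j = -1) :
    f A B r = -l (block 0 0 0 1) • gV K m (by omega) A B r
      + cobd p i j (lowCochain (by omega) N) A B r := by
  have hm0 : 0 < m := by omega
  have key : ∀ {A B : gl K m 1}, HasWt K 0 A → HasWt K (-1) B → f A B ⟨0, hm0⟩
      = -l (block 0 0 0 1) • gV K m hm0 A B ⟨0, hm0⟩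
        + cobd p 0 1 (lowCochain hm0 N) A B ⟨0, hm0⟩ := by
    intro A B hA hB
    have h1 : rho K B (lowCochain hm0 N A) ⟨0, hm0⟩ = 0 :=
      hB.rho_eq_zero fun s hs => absurd hs (by simp)
    rw [hN A B hA hB, eq_smul_str (fun X B hX hB => hf.map_sbr_eq_zero hm hN hX hB) hA, gV_eq,
      hB.str_eq_zero (by decide), cobd]
    simp only [Pi.sub_apply, Pi.smul_apply, h1, mul_zero, sg_zero, one_smul, smul_zero, sub_zero,
      zero_smul, rho_covTop hm0 hA (lowCochain_zero hm0 N B), lowCochain_zero,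
      rowy_sbr hA hB.isHom, topAct, Pi.single_eq_same]
    rw [Pi.zero_apply, sub_zero, smul_smul, ← map_sub, add_comm]
    congr 2
    simp only [Matrix.vecMul_sub, Matrix.sub_vecMul, Matrix.smul_vecMul, Matrix.vecMul_vecMul]
    abel
  have hcases : (i = 0 ∧ j = -1 ∧ (r : ℕ) = 0) ∨ (i = -1 ∧ j = 0 ∧ (r : ℕ) = 0)
      ∨ (i = -1 ∧ j = -1 ∧ (r : ℕ) = 1) := by omega
  have hcast : ((-1 : ℤ) : ZMod 2) = 1 := by decide
  rcases hcases with ⟨rfl, rfl, hr⟩ | ⟨rfl, rfl, hr⟩ | ⟨rfl, rfl, hr⟩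
  · obtain rfl : r = ⟨0, hm0⟩ := Fin.ext hr
    rw [hcast, Int.cast_zero]
    exact key hA hB
  · obtain rfl : r = ⟨0, hm0⟩ := Fin.ext hr
    rw [hcast, Int.cast_zero, hf.skew 0 1 _ _ hB.isHom_zero hA.isHom_neg_one, gV_swap,
      cobd_swap _ hB.isHom_zero hA.isHom_neg_one]
    simp only [Pi.neg_apply, zero_mul, sg_zero, one_smul, key hB hA]
    module
  · obtain rfl : r = ⟨1, hm⟩ := Fin.ext hr
    have hsbr : sbr K A B = 0 := (hA.sbr hB).eq_zero (by decide) (by decide) (by decide)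
    have hrho : ∀ {A B : gl K m 1}, HasWt K (-1) A → rho K A (lowCochain hm0 N B) ⟨1, hm⟩
        = ctr K (blky K A) (covTop K m (rowy K B ᵥ* N)) := by
      intro A B hA
      rw [rho_apply, hA.blka_eq_zero (by decide), hA.blkd_eq_zero (by decide),
        hA.blkx_eq_zero (by decide), theta_zero, wmul_zero]
      simp [lowCochain_zero]
    rw [hcast, hf.slot_one_eq hm hN hA hB, gV_eq, hA.str_eq_zero (by decide),
      hB.str_eq_zero (by decide), cobd, hsbr]
    simp only [Pi.sub_apply, Pi.smul_apply, hrho hA, hrho hB, map_zero, sg_add, sg_one, mul_one,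
      Pi.zero_apply]
    module

/-- Every `2`-cocycle is a multiple of `g` plus a coboundary. -/
theorem IsTwoCocycle.exists_eq_smul_gV_add_cobd [CharZero K] (hf : IsTwoCocycle p f) (hm : 1 < m) :
    ∃ (c : K) (φ : gl K m 1 →ₗ[K] Wam K m),
      (∀ (q : ZMod 2) (A : gl K m 1), IsHom K q A → φ A ∈ Vpart K m (q + p)) ∧
      ∀ (pA pB : ZMod 2) (A B : gl K m 1), IsHom K pA A → IsHom K pB B →
        f A B = c • gV K m (by omega) A B + cobd p pA pB φ A B := by
  have hm0 : 0 < m := by omega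
  obtain ⟨N, l, hNp, hN⟩ := hf.exists_primitive hm0
  refine ⟨-l (block 0 0 0 1), homotopy f + lowCochain hm0 N, fun q A hA => ?_, ?_⟩
  · exact Submodule.add_mem _ (homotopy_mem hf hA) (lowCochain_mem hm0 hNp hA)
  have key : ∀ {i j : ℤ} {pA pB : ZMod 2} {A B : gl K m 1}, -1 ≤ i → -1 ≤ j →
      IsHom K pA A → IsHom K pB B → HasWt K i A → HasWt K j B →
      f A B = -l (block 0 0 0 1) • gV K m hm0 A B
        + cobd p pA pB (homotopy f + lowCochain hm0 N) A B := by
    intro i j pA pB A B hi hj hpA hpB hA hB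
    rcases hpA.eq_zero_or hA with rfl | rfl
    · have h1 : gV K m hm0 0 B = 0 := by simpa using gV_smul_left hm0 0 0 B
      have h2 := cobd_add_left p pA pB (homotopy f + lowCochain hm0 N) 0 0 B
      simp only [add_zero, left_eq_add] at h2
      simp [h1, h2]
    rcases hpB.eq_zero_or hB with rfl | rfl
    · have h1 : gV K m hm0 A 0 = 0 := by simpa using gV_smul_right hm0 0 A 0
      have h2 := cobd_add_right p i pB (homotopy f + lowCochain hm0 N) A 0 0
      simp only [add_zero, left_eq_add] at h2
      simp [h1, h2]
    ext1 r
    rw [cobd_add, Pi.add_apply, Pi.smul_apply, Pi.add_apply, cobd_homotopy hf hA hB]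
    by_cases h : (r : ℤ) + i + j = -1
    · rw [show (-1 - (r : ℕ) - i - j : ℤ) = 0 by omega, Int.cast_zero, zero_smul, smul_zero,
        zero_add]
      exact hf.eq_of_invariant hm hN hA hB hi hj h
    · have hw : ((-1 - (r : ℕ) - i - j : ℤ) : K) ≠ 0 := Int.cast_ne_zero.2 (by omega)
      rw [gV_apply_eq_zero hm0 hA hB h, cobd_lowCochain_eq_zero hm0 N hA hB h, smul_smul,
        inv_mul_cancel₀ hw]
      simp
  have keyB : ∀ {i : ℤ} {pA pB : ZMod 2} {A B : gl K m 1}, -1 ≤ i →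
      IsHom K pA A → IsHom K pB B → HasWt K i A →
      f A B = -l (block 0 0 0 1) • gV K m hm0 A B
        + cobd p pA pB (homotopy f + lowCochain hm0 N) A B := by
    intro i pA pB A B hi hpA hpB hA
    rw [sum_wtProj B]
    simp only [map_add, gV_add_right, cobd_add_right]
    rw [key hi (by decide) hpA (hpB.wtProj (-1)) hA (hasWt_wtProj _ _),
      key hi (by decide) hpA (hpB.wtProj 0) hA (hasWt_wtProj _ _),
      key hi (by decide) hpA (hpB.wtProj 1) hA (hasWt_wtProj _ _)]
    module
  intro pA pB A B hpA hpB
  rw [sum_wtProj A]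
  simp only [map_add, LinearMap.add_apply, gV_add_left, cobd_add_left]
  rw [keyB (by decide) (hpA.wtProj (-1)) hpB (hasWt_wtProj _ _),
    keyB (by decide) (hpA.wtProj 0) hpB (hasWt_wtProj _ _),
    keyB (by decide) (hpA.wtProj 1) hpB (hasWt_wtProj _ _)]
  module

end Classification

section NotCoboundary

variable {m : ℕ} {K}

lemma gV_mem (hm : 0 < m) {pA pB : ZMod 2} {A B : gl K m 1} (hA : IsHom K pA A)
    (hB : IsHom K pB B) : gV K m hm A B ∈ Vpart K m (pA + pB + (m : ZMod 2)) := by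
  have hcast : ((m - 1 : ℕ) : ZMod 2) = 1 + m := by
    rw [Nat.cast_sub hm, Nat.cast_one]
    generalize (m : ZMod 2) = a
    revert a; decide
  have htop : ∀ C : gl K m 1, topAct K hm C ∈ Vpart K m (1 + (m : ZMod 2)) := by
    intro C r _
    by_cases hr : r = ⟨0, hm⟩
    · subst hr
      rw [topAct, Pi.single_eq_same]
      dsimp only
      rw [Nat.sub_zero, if_pos hcast]
      exact covTop_mem K _
    · rw [topAct, Pi.single_eq_of_ne hr]
      exact Submodule.zero_mem _
  rw [gV_eq]
  rcases zmod_two_cases pA with rfl | rfl <;> rcases zmod_two_cases pB with rfl | rfl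
  · rw [topAct_even hm hA, topAct_even hm hB, smul_zero, smul_zero, sub_zero]
    exact Submodule.zero_mem _
  · rw [hB.str_eq_zero, zero_smul, sub_zero, zero_add]
    exact Submodule.smul_mem _ _ (htop B)
  · rw [hA.str_eq_zero, zero_smul, zero_sub, add_zero]
    exact Submodule.neg_mem _ (Submodule.smul_mem _ _ (htop A))
  · rw [hA.str_eq_zero, hB.str_eq_zero, zero_smul, zero_smul, sub_zero]
    exact Submodule.zero_mem _

lemma gV_skew (hm : 0 < m) {pA pB : ZMod 2} {A B : gl K m 1} (hA : IsHom K pA A)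
    (hB : IsHom K pB B) : gV K m hm B A = -(sg K (pA * pB) • gV K m hm A B) := by
  rw [gV_swap]
  rcases zmod_two_cases pA with rfl | rfl
  · rw [zero_mul, sg_zero, one_smul]
  rcases zmod_two_cases pB with rfl | rfl
  · rw [mul_zero, sg_zero, one_smul]
  · rw [gV_eq, hA.str_eq_zero, hB.str_eq_zero, zero_smul, zero_smul, sub_zero, smul_zero]

lemma gV_ne_cobd [CharZero K] (hm : 1 < m) :
    ¬ ∃ φ : gl K m 1 →ₗ[K] Wam K m,
      (∀ (q : ZMod 2) (A : gl K m 1), IsHom K q A → φ A ∈ Vpart K m (q + (m : ZMod 2))) ∧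
      ∀ (pA pB : ZMod 2) (A B : gl K m 1), IsHom K pA A → IsHom K pB B →
        gV K m (by omega) A B = cobd (m : ZMod 2) pA pB φ A B := by
  rintro ⟨φ, hφ, h⟩
  have hm0 : 0 < m := by omega
  have hA := hasWt_block_zero (K := K) (1 : Matrix (Fin m) (Fin m) K) 1
  have hB := hasWt_block_neg_one (K := K) (Pi.single ⟨0, hm0⟩ 1 : Fin m → K)
  set A : gl K m 1 := block 1 0 0 1 with hAdef
  set B : gl K m 1 := block 0 0 (Pi.single ⟨0, hm0⟩ 1) 0 with hBdef
  have h1 := congrFun (h 0 1 A B hA.isHom_zero hB.isHom_neg_one) ⟨0, hm0⟩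
  have hmem := Vpart_le_Vsub (hφ _ _ hB.isHom) ⟨0, hm0⟩
  have hsbr : sbr K A B = 0 := by
    have hAB : HasWt K (-1) (sbr K A B) := by simpa using hA.sbr hB
    refine hAB.ext_neg_one (fun i j h => absurd rfl h) ?_
    rw [rowy_sbr hA hB.isHom, hAdef, blkd_block, blka_block, one_smul, Matrix.vecMul_one, sub_self]
    rfl
  have hrho : rho K A (φ B) ⟨0, hm0⟩ = 0 := by
    rw [rho_covTop hm0 hA (eq_covTop K hm0 hmem), hAdef, blkd_block, blka_block, one_smul,
      Matrix.vecMul_one, sub_self, map_zero]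
  simp only [cobd, hsbr, map_zero, Pi.sub_apply, Pi.smul_apply, hrho,
    hB.rho_eq_zero (r := ⟨0, hm0⟩) fun s hs => absurd hs (by simp), smul_zero, sub_zero,
    Pi.zero_apply] at h1
  rw [gV_eq, hB.str_eq_zero (by decide), zero_smul, sub_zero, Pi.smul_apply, topAct,
    Pi.single_eq_same, ← map_smul] at h1
  have h2 := congrFun (covTop_injective (h1.trans (map_zero _).symm)) ⟨0, hm0⟩
  rw [hBdef, rowy_block, str_eq, hAdef, blka_block, blkd_block] at h2
  simp only [Matrix.trace_one, Fintype.card_fin, Pi.smul_apply, Pi.single_eq_same, smul_eq_mul,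
    mul_one, Pi.zero_apply, sub_eq_zero] at h2
  exact hm.ne' (by exact_mod_cast h2)

end NotCoboundary

/-- Let `m ≥ 2` and `G = gl(m|1)` acting on `V` via `ρ`.  The map `g`
above is a 2-cocycle of `G` with coefficients in `V` which is not a 2-coboundary, and
every 2-cocycle of `G` with coefficients in `V` is a scalar multiple of `g` plus a
2-coboundary; in particular `H²(G,V)` is one-dimensional. -/
theorem second_cohomology_gl_m_1_coefficients_V_one_dimensional
    (K : Type) [Field K] [IsAlgClosed K] [CharZero K] (m : ℕ) (hm : 2 ≤ m) :
    -- `g` is bilinear ...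
    (∀ (c : K) (A A' B : gl K m 1),
      gV K m (by omega) (c • A + A') B = c • gV K m (by omega) A B + gV K m (by omega) A' B) ∧
    (∀ (c : K) (A B B' : gl K m 1),
      gV K m (by omega) A (c • B + B') = c • gV K m (by omega) A B + gV K m (by omega) A B') ∧
    -- ... a super-skew-symmetric 2-cochain of parity `m mod 2` with values in `V` ...
    (∀ (pA pB : ZMod 2) (A B : gl K m 1), IsHom K pA A → IsHom K pB B →
      gV K m (by omega) A B ∈ Vpart K m (pA + pB + (m : ZMod 2))) ∧
    (∀ (pA pB : ZMod 2) (A B : gl K m 1), IsHom K pA A → IsHom K pB B →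
      gV K m (by omega) B A = -(sg K (pA * pB) • gV K m (by omega) A B)) ∧
    -- ... satisfying the 2-cocycle identity ...
    (∀ (pA pB pC : ZMod 2) (A B C : gl K m 1),
      IsHom K pA A → IsHom K pB B → IsHom K pC C →
      sg K ((m : ZMod 2) * pA) • rho K A (gV K m (by omega) B C)
        - sg K (pA * pB + (m : ZMod 2) * pB) • rho K B (gV K m (by omega) A C)
        + sg K ((pA + pB) * pC + (m : ZMod 2) * pC) • rho K C (gV K m (by omega) A B)
        - gV K m (by omega) (sbr K A B) C + sg K (pB * pC) • gV K m (by omega) (sbr K A C) B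
        + gV K m (by omega) A (sbr K B C) = 0) ∧
    -- ... `g` is not a 2-coboundary ...
    (¬ ∃ φ : gl K m 1 →ₗ[K] Wam K m,
      (∀ (q : ZMod 2) (A : gl K m 1), IsHom K q A → φ A ∈ Vpart K m (q + (m : ZMod 2))) ∧
      (∀ (pA pB : ZMod 2) (A B : gl K m 1), IsHom K pA A → IsHom K pB B →
        gV K m (by omega) A B = sg K ((m : ZMod 2) * pA) • rho K A (φ B)
          - sg K (pA * pB + (m : ZMod 2) * pB) • rho K B (φ A) - φ (sbr K A B))) ∧
    -- ... and every 2-cocycle of `G` with coefficients in `V` is a scalar multiple of `g`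
    -- plus a 2-coboundary.
    (∀ (p : ZMod 2) (f : gl K m 1 →ₗ[K] gl K m 1 →ₗ[K] Wam K m),
      (∀ (pA pB : ZMod 2) (A B : gl K m 1), IsHom K pA A → IsHom K pB B →
        f A B ∈ Vpart K m (pA + pB + p)) →
      (∀ (pA pB : ZMod 2) (A B : gl K m 1), IsHom K pA A → IsHom K pB B →
        f B A = -(sg K (pA * pB) • f A B)) →
      (∀ (pA pB pC : ZMod 2) (A B C : gl K m 1),
        IsHom K pA A → IsHom K pB B → IsHom K pC C →
        sg K (p * pA) • rho K A (f B C)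
          - sg K (pA * pB + p * pB) • rho K B (f A C)
          + sg K ((pA + pB) * pC + p * pC) • rho K C (f A B)
          - f (sbr K A B) C + sg K (pB * pC) • f (sbr K A C) B + f A (sbr K B C) = 0) →
      ∃ (c : K) (φ : gl K m 1 →ₗ[K] Wam K m),
        (∀ (q : ZMod 2) (A : gl K m 1), IsHom K q A → φ A ∈ Vpart K m (q + p)) ∧
        (∀ (pA pB : ZMod 2) (A B : gl K m 1), IsHom K pA A → IsHom K pB B →
          f A B = c • gV K m (by omega) A B + sg K (p * pA) • rho K A (φ B)
            - sg K (pA * pB + p * pB) • rho K B (φ A) - φ (sbr K A B))) := by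
  have hm0 : 0 < m := by omega
  refine ⟨fun c A A' B => ?_, fun c A B B' => ?_, fun _ _ _ _ hA hB => gV_mem hm0 hA hB,
    fun _ _ _ _ hA hB => gV_skew hm0 hA hB,
    fun _ _ _ _ _ _ hA hB hC => gV_cocycle hm0 hA hB hC, gV_ne_cobd hm, ?_⟩
  · rw [gV_add_left, gV_smul_left]
  · rw [gV_add_right, gV_smul_right]
  intro p f hmem hskew hcocycle
  obtain ⟨c, φ, hφ, h⟩ :=
    (IsTwoCocycle.mk hmem hskew hcocycle).exists_eq_smul_gV_add_cobd hm
  refine ⟨c, φ, hφ, fun pA pB A B hA hB => ?_⟩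
  rw [h pA pB A B hA hB, cobd]
  abel
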